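/- arXiv:2111.02888 — 13 statements merged into one kernel-verified Lean document; each statement's English description precedes it below -/
import Mathlib

section
/- For every positive integer z and every integer x with 0 ≤ x ≤ z, it is not the case that both x² + z² and (z−x)² + z² are perfect squares. (Equivalently: on the edge of a square with integer side length, no point has integer distances to all four vertices.) -/
/-- A nonnegative integer is a perfect square: `m = w^2` for some integer `w`. -/
def IsSq (m : ℤ) : Prop := ∃ w : ℤ, m = w ^ 2

theorem isCoprime_sq_add_sq_mul {b c : ℤ} (h : IsCoprime b c) :
    IsCoprime (b ^ 2 + c ^ 2) (b * c) := by
  have hb : IsCoprime (c ^ 2 + b * b) b := IsCoprime.add_mul_left_left h.symm.pow_left b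
  have hc : IsCoprime (b ^ 2 + c * c) c := IsCoprime.add_mul_left_left h.pow_left c
  refine IsCoprime.mul_right ?_ ?_
  · convert hb using 1; ring
  · convert hc using 1; ring

theorem isCoprime_sq_sub_sq_mul {b c : ℤ} (h : IsCoprime b c) :
    IsCoprime (b ^ 2 - c ^ 2) (b * c) := by
  have hb : IsCoprime (-c ^ 2 + b * b) b :=
    IsCoprime.add_mul_left_left h.symm.pow_left.neg_left b
  have hc : IsCoprime (b ^ 2 + c * (-c)) c := IsCoprime.add_mul_left_left h.pow_left (-c)
  refine IsCoprime.mul_right ?_ ?_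
  · convert hb using 1; ring
  · convert hc using 1; ring

/-- The four-number lemma: two factorizations of the same integer have a common refinement. -/
theorem exists_common_refinement {m n p q : ℤ} (hm : m ≠ 0) (h : m * n = p * q) :
    ∃ α β γ δ : ℤ, m = α * β ∧ n = γ * δ ∧ p = α * γ ∧ q = β * δ := by
  obtain ⟨α, β, ⟨γ, hγ⟩, ⟨δ, hδ⟩, rfl⟩ := exists_dvd_and_dvd_of_dvd_mul (Dvd.intro n h)
  refine ⟨α, β, γ, δ, rfl, mul_left_cancel₀ hm ?_, hγ, hδ⟩
  rw [h, hγ, hδ]; ring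

/-- One step of the descent for `b⁴ + 3b²c² + c⁴ = w²`. -/
theorem quartic_descent {b c w : ℤ} (hbc : IsCoprime b c) (hb : b ≠ 0) (hc : c ≠ 0)
    (hb2 : b % 2 = 0) (h : b ^ 4 + 3 * b ^ 2 * c ^ 2 + c ^ 4 = w ^ 2) :
    ∃ u v i : ℤ, IsCoprime u v ∧ u ≠ 0 ∧ v ≠ 0 ∧ (u * v).natAbs < (b * c).natAbs ∧
      u ^ 4 + 3 * u ^ 2 * v ^ 2 + v ^ 4 = i ^ 2 := by
  obtain ⟨b, rfl⟩ := Int.dvd_of_emod_eq_zero hb2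
  have hc2 : c % 2 = 1 := by
    rw [← Int.odd_iff, ← Int.isCoprime_two_left]
    exact hbc.of_mul_left_left
  have hw : w ≠ 0 := by
    rintro rfl
    have : 0 < c ^ 4 := by positivity
    nlinarith [sq_nonneg ((2 * b) ^ 2), sq_nonneg (2 * b * c)]
  have hodd : ((2 * b) ^ 2 + c ^ 2) % 2 = 1 := by
    obtain ⟨k, rfl⟩ := Int.odd_iff.2 hc2
    ring_nf
    omega
  have htriple : PythagoreanTriple ((2 * b) ^ 2 + c ^ 2) (2 * b * c) |w| := by
    unfold PythagoreanTriple
    rw [abs_mul_abs_self]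
    linear_combination h
  obtain ⟨s, t, h₁, h₂, -⟩ := htriple.coprime_classification'
    (Int.isCoprime_iff_gcd_eq_one.1 (isCoprime_sq_add_sq_mul hbc)) hodd (abs_pos.2 hw)
  have hst : s * t = b * c := by linarith
  have hb0 : b ≠ 0 := by rintro rfl; simp at hb
  have hs : s ≠ 0 := by
    rintro rfl
    exact mul_ne_zero hb0 hc (by linarith)
  obtain ⟨i, k, j, l, rfl, rfl, rfl, rfl⟩ := exists_common_refinement hs hst
  have hi : i ≠ 0 := left_ne_zero_of_mul hb0
  have hj : j ≠ 0 := right_ne_zero_of_mul hb0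
  have hk : k ≠ 0 := left_ne_zero_of_mul hc
  have hl : l ≠ 0 := right_ne_zero_of_mul hc
  have hbc' : IsCoprime (i * j) (k * l) := hbc.of_mul_left_right
  have hil : IsCoprime i l := hbc'.of_mul_left_left.of_mul_right_right
  have hjk : IsCoprime j k := hbc'.of_mul_left_right.of_mul_right_left
  have hjl : IsCoprime j l := hbc'.of_mul_left_right.of_mul_right_right
  have hk2 : k % 2 = 1 := Int.odd_iff.1 (Int.odd_mul.1 (Int.odd_iff.2 hc2)).1
  have hl2 : l % 2 = 1 := Int.odd_iff.1 (Int.odd_mul.1 (Int.odd_iff.2 hc2)).2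
  have key : i ^ 2 * (k ^ 2 - 4 * j ^ 2) = l ^ 2 * (j ^ 2 + k ^ 2) := by
    linear_combination -h₁
  obtain ⟨e, he⟩ : i ^ 2 ∣ j ^ 2 + k ^ 2 :=
    (hil.pow (m := 2) (n := 2)).dvd_of_dvd_mul_left (Dvd.intro _ key)
  have he' : k ^ 2 - 4 * j ^ 2 = l ^ 2 * e := by
    apply mul_left_cancel₀ (pow_ne_zero 2 hi)
    rw [key, he]; ring
  have hepos : 0 < e := by
    have : 0 < i ^ 2 * e := by rw [← he]; positivity
    exact pos_of_mul_pos_right this (sq_nonneg i)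
  have he5 : e ∣ 5 := by
    obtain ⟨p, q, hpq⟩ := hjk.pow (m := 2) (n := 2)
    refine ⟨p * (i ^ 2 - l ^ 2) + q * (4 * i ^ 2 + l ^ 2), ?_⟩
    linear_combination -5 * hpq + (p + 4 * q) * he + (q - p) * he'
  have hele : e ≤ 5 := Int.le_of_dvd (by norm_num) he5
  have he1 : e = 1 ∨ e = 5 := by interval_cases e <;> omega
  rcases he1 with rfl | rfl
  · have htriple' : PythagoreanTriple l (2 * j) |k| := by
      unfold PythagoreanTriple
      rw [abs_mul_abs_self]
      linear_combination -he'
    have hcop : IsCoprime l (2 * j) :=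
      (Int.isCoprime_two_right.2 (Int.odd_iff.2 hl2)).mul_right hjl.symm
    obtain ⟨u, v, -, h₄, h₅, huv, -⟩ := htriple'.coprime_classification'
      (Int.isCoprime_iff_gcd_eq_one.1 hcop) hl2 (abs_pos.2 hk)
    obtain rfl : j = u * v := by linarith
    refine ⟨u, v, i, Int.isCoprime_iff_gcd_eq_one.2 huv, left_ne_zero_of_mul hj,
      right_ne_zero_of_mul hj, ?_, ?_⟩
    · have hrw : 2 * (i * (u * v)) * (k * l) = u * v * (2 * (i * (k * l))) := by ring
      rw [hrw, Int.natAbs_mul (u * v), Int.natAbs_mul 2]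
      have h₆ : 0 < (u * v).natAbs := Int.natAbs_pos.2 hj
      have h₇ : 0 < (i * (k * l)).natAbs := Int.natAbs_pos.2 (mul_ne_zero hi hc)
      have h₈ : (2 : ℤ).natAbs = 2 := rfl
      rw [h₈]
      nlinarith
    · have h₆ : k ^ 2 = (u ^ 2 + v ^ 2) ^ 2 := by rw [← h₅, sq_abs]
      linear_combination he - h₆
  · exfalso
    obtain ⟨k, rfl⟩ := Int.odd_iff.2 hk2
    obtain ⟨l, rfl⟩ := Int.odd_iff.2 hl2
    obtain ⟨l', hl'⟩ := Int.even_mul_succ_self l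
    obtain ⟨k', hk'⟩ := Int.even_mul_succ_self k
    rcases Int.even_or_odd' j with ⟨j, rfl | rfl⟩
    · have : 4 * (k * (k + 1)) + 1 - 16 * j ^ 2 = 5 * (4 * (l * (l + 1)) + 1) := by
        linear_combination he'
      omega
    · have : 4 * (k * (k + 1)) + 1 + 4 * (j ^ 2 + j) + 1 = 5 * i ^ 2 := by
        linear_combination he
      rcases Int.even_or_odd' i with ⟨i, rfl | rfl⟩
      · ring_nf at this; omega
      · ring_nf at this; omega

/-- The equation `b⁴ + 3b²c² + c⁴ = w²` has no solutions in nonzero coprime integers. -/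
theorem quartic_ne_sq {b c w : ℤ} (hbc : IsCoprime b c) (hb : b ≠ 0) (hc : c ≠ 0) :
    b ^ 4 + 3 * b ^ 2 * c ^ 2 + c ^ 4 ≠ w ^ 2 := by
  intro h
  induction hN : (b * c).natAbs using Nat.strong_induction_on generalizing b c w with
  | _ N ih =>
  subst hN
  rcases Int.emod_two_eq_zero_or_one b with hb2 | hb2
  · obtain ⟨u, v, i, huv, hu, hv, hlt, h'⟩ := quartic_descent hbc hb hc hb2 h
    exact ih _ hlt huv hu hv h' rfl
  rcases Int.emod_two_eq_zero_or_one c with hc2 | hc2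
  · obtain ⟨u, v, i, huv, hu, hv, hlt, h'⟩ :=
      quartic_descent (w := w) hbc.symm hc hb hc2 (by linear_combination h)
    rw [mul_comm c b] at hlt
    exact ih _ hlt huv hu hv h' rfl
  obtain ⟨b, rfl⟩ := Int.odd_iff.2 hb2
  obtain ⟨c, rfl⟩ := Int.odd_iff.2 hc2
  obtain ⟨p, hp⟩ := Int.even_mul_succ_self b
  obtain ⟨q, hq⟩ := Int.even_mul_succ_self c
  have hp' : (2 * b + 1) ^ 2 = 8 * p + 1 := by linear_combination 4 * hp
  have hq' : (2 * c + 1) ^ 2 = 8 * q + 1 := by linear_combination 4 * hq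
  have h₁ : (8 * p + 1) ^ 2 + 3 * ((8 * p + 1) * (8 * q + 1)) + (8 * q + 1) ^ 2 = w ^ 2 := by
    rw [← hp', ← hq', ← h]; ring
  rcases Int.even_or_odd' w with ⟨w, rfl | rfl⟩
  · ring_nf at h₁; omega
  · obtain ⟨r, hr⟩ := Int.even_mul_succ_self w
    have hr' : (2 * w + 1) ^ 2 = 8 * r + 1 := by linear_combination 4 * hr
    rw [hr'] at h₁
    ring_nf at h₁
    omega

theorem sq_sub_sq_mul_sq_add_sq_ne {α β γ δ : ℤ} (hαδ : IsCoprime α δ) (hβγ : IsCoprime β γ)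
    (hα : α ≠ 0) (hβ : β ≠ 0) (hγ : γ ≠ 0) (hδ : δ ≠ 0) :
    (α ^ 2 - δ ^ 2) * (β ^ 2 + γ ^ 2) ≠ 2 * (α * δ) * (β * γ) := by
  intro h
  obtain ⟨c, hc⟩ : α * δ ∣ β ^ 2 + γ ^ 2 :=
    (isCoprime_sq_sub_sq_mul hαδ).symm.dvd_of_dvd_mul_left
      (Dvd.intro (2 * (β * γ)) (by linear_combination -h))
  obtain ⟨d, hd⟩ : β * γ ∣ α ^ 2 - δ ^ 2 :=
    (isCoprime_sq_add_sq_mul hβγ).symm.dvd_of_dvd_mul_right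
      (Dvd.intro (2 * (α * δ)) (by linear_combination -h))
  have hcd : c * d = 2 := by
    have hne : α * δ * (β * γ) ≠ 0 := by positivity
    apply mul_left_cancel₀ hne
    rw [hc, hd] at h
    linear_combination h
  have hsum : (α ^ 2 + δ ^ 2) ^ 2 = (β * γ * d) ^ 2 + 4 * (α * δ) ^ 2 := by
    rw [← hd]; ring
  have hc2 : c ∣ 2 := Dvd.intro d hcd
  have hcle : c ≤ 2 := Int.le_of_dvd (by norm_num) hc2
  have hcge : -c ≤ 2 := Int.le_of_dvd (by norm_num) ((neg_dvd).2 hc2)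
  have hcases : c ^ 2 = 1 ∧ d ^ 2 = 4 ∨ 2 ∣ c ∧ d ^ 2 = 1 := by
    have : -2 ≤ c := by linarith
    interval_cases c
    · obtain rfl : d = -1 := by linarith
      norm_num
    · obtain rfl : d = -2 := by linarith
      norm_num
    · omega
    · obtain rfl : d = 2 := by linarith
      norm_num
    · obtain rfl : d = 1 := by linarith
      norm_num
  rcases hcases with ⟨hc1, hd4⟩ | ⟨⟨c, rfl⟩, hd1⟩
  · have hs : (α * δ) ^ 2 = (β ^ 2 + γ ^ 2) ^ 2 := by
      rw [hc]; linear_combination -(α * δ) ^ 2 * hc1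
    have hsq : (α ^ 2 + δ ^ 2) ^ 2 = 2 ^ 2 * (β ^ 4 + 3 * β ^ 2 * γ ^ 2 + γ ^ 4) := by
      linear_combination hsum + (β * γ) ^ 2 * hd4 + 4 * hs
    obtain ⟨w, hw⟩ : (2 : ℤ) ∣ α ^ 2 + δ ^ 2 :=
      (Int.pow_dvd_pow_iff two_ne_zero).1 (Dvd.intro _ hsq.symm)
    refine quartic_ne_sq (w := w) hβγ hβ hγ ?_
    rw [hw] at hsq
    linarith
  · have hβγ2 : ¬ (2 ∣ β ∧ 2 ∣ γ) := fun ⟨h₁, h₂⟩ => by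
      have := hβγ.isUnit_of_dvd' h₁ h₂
      exact absurd this (by decide)
    have hd2 : Odd d := by
      rcases sq_eq_sq_iff_eq_or_eq_neg.1 (hd1.trans (one_pow 2).symm) with rfl | rfl <;> decide
    rcases Int.even_or_odd' β with ⟨β, rfl | rfl⟩ <;> rcases Int.even_or_odd' γ with ⟨γ, rfl | rfl⟩
    · exact hβγ2 ⟨Dvd.intro _ rfl, Dvd.intro _ rfl⟩
    · ring_nf at hc; omega
    · ring_nf at hc; omega
    · have hodd : Odd (α ^ 2 - δ ^ 2) := by
        rw [hd]
        exact ((odd_two_mul_add_one β).mul (odd_two_mul_add_one γ)).mul hd2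
      have heven : Even (α * δ) := by
        rw [Int.odd_sub, Int.odd_pow' two_ne_zero, Int.even_pow' two_ne_zero] at hodd
        rw [Int.even_mul]
        rcases Int.even_or_odd α with hα2 | hα2
        · exact Or.inl hα2
        · exact Or.inr (hodd.1 hα2)
      obtain ⟨r, hr⟩ := heven
      rw [hr] at hc
      ring_nf at hc
      omega

/-- No coprime `x, z` with `z ≠ 0` make both `x² + z²` and `(z - x)² + z²` squares. -/
theorem not_sq_and_sq_of_isCoprime {x z a b : ℤ} (hz : z ≠ 0) (hxz : IsCoprime x z)
    (ha : x ^ 2 + z ^ 2 = a ^ 2) (hb : (z - x) ^ 2 + z ^ 2 = b ^ 2) : False := by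
  have hyz : IsCoprime (z - x) z := by
    rw [show z - x = -x + z * 1 by ring]
    exact IsCoprime.add_mul_left_left hxz.neg_left 1
  have ha0 : a ≠ 0 := by
    rintro rfl
    have : 0 < z ^ 2 := by positivity
    nlinarith [sq_nonneg x]
  have hb0 : b ≠ 0 := by
    rintro rfl
    have : 0 < z ^ 2 := by positivity
    nlinarith [sq_nonneg (z - x)]
  have ta : PythagoreanTriple x z |a| := by
    unfold PythagoreanTriple
    rw [abs_mul_abs_self]; linear_combination ha
  have tb : PythagoreanTriple (z - x) z |b| := by
    unfold PythagoreanTriple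
    rw [abs_mul_abs_self]; linear_combination hb
  have hga := Int.isCoprime_iff_gcd_eq_one.1 hxz
  have hgb := Int.isCoprime_iff_gcd_eq_one.1 hyz
  have hpar : x % 2 = 1 ∧ (z - x) % 2 = 1 := by
    rcases ta.even_odd_of_coprime hga with h₁ | h₁ <;>
      rcases tb.even_odd_of_coprime hgb with h₂ | h₂ <;> omega
  obtain ⟨m, n, hx, hz₁, -, hmn, -⟩ := ta.coprime_classification' hga hpar.1 (abs_pos.2 ha0)
  obtain ⟨p, q, hy, hz₂, -, hpq, -⟩ := tb.coprime_classification' hgb hpar.2 (abs_pos.2 hb0)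
  rw [← Int.isCoprime_iff_gcd_eq_one] at hmn hpq
  have hm : m ≠ 0 := by rintro rfl; simp at hz₁; exact hz hz₁
  have hn : n ≠ 0 := by rintro rfl; simp at hz₁; exact hz hz₁
  obtain ⟨α, β, γ, δ, rfl, rfl, rfl, rfl⟩ :=
    exists_common_refinement (m := m) (n := n) (p := p) (q := q) hm (by linarith)
  refine sq_sub_sq_mul_sq_add_sq_ne hmn.of_mul_left_left.of_mul_right_right
    hmn.of_mul_left_right.of_mul_right_left (left_ne_zero_of_mul hm) (right_ne_zero_of_mul hm)
    (left_ne_zero_of_mul hn) (right_ne_zero_of_mul hn) ?_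
  linear_combination hz₁ - hx - hy

/-- On the edge of a square with integer side length, no point has integer distances
to all four vertices. -/
theorem no_point_on_edge (z x : ℤ) (hz : 0 < z) (hx0 : 0 ≤ x) (hxz : x ≤ z) :
    ¬ (IsSq (x ^ 2 + z ^ 2) ∧ IsSq ((z - x) ^ 2 + z ^ 2)) := by
  rintro ⟨⟨a, ha⟩, b, hb⟩
  have hg : (Int.gcd x z : ℤ) ≠ 0 := by
    rw [Ne, Int.natCast_eq_zero, Int.gcd_eq_zero_iff]
    omega
  obtain ⟨x', hx'⟩ := Int.gcd_dvd_left x z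
  obtain ⟨z', hz'⟩ := Int.gcd_dvd_right x z
  have hcop : IsCoprime x' z' := by
    obtain ⟨r, s, hrs⟩ : ∃ r s, (Int.gcd x z : ℤ) = x * r + z * s :=
      ⟨_, _, Int.gcd_eq_gcd_ab x z⟩
    refine ⟨r, s, mul_left_cancel₀ hg ?_⟩
    linear_combination -hrs - r * hx' - s * hz'
  generalize (Int.gcd x z : ℤ) = g at *
  subst hx' hz'
  obtain ⟨a, rfl⟩ : g ∣ a := (Int.pow_dvd_pow_iff two_ne_zero).1
    (Dvd.intro (x' ^ 2 + z' ^ 2) (by linear_combination ha))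
  obtain ⟨b, rfl⟩ : g ∣ b := (Int.pow_dvd_pow_iff two_ne_zero).1
    (Dvd.intro ((z' - x') ^ 2 + z' ^ 2) (by linear_combination hb))
  have hg2 : g ^ 2 ≠ 0 := pow_ne_zero 2 hg
  exact not_sq_and_sq_of_isCoprime (a := a) (b := b) (right_ne_zero_of_mul hz.ne') hcop
    (mul_left_cancel₀ hg2 (by linear_combination ha))
    (mul_left_cancel₀ hg2 (by linear_combination hb))
end

section
/- For every positive integer a and every integer y with 0 ≤ y ≤ 2a, it is not the case that both a² + y² and a² + (2a−y)² are perfect squares. (Equivalently: on a midline of a square with integer side length, no point has integer distances to all four vertices.) -/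
/-- If a product of coprime integers is a square, then the squares of both factors are
fourth powers. -/
theorem Int.exists_sq_eq_pow_four_of_mul_eq_sq {p q s : ℤ} (hpq : IsCoprime p q)
    (h : p * q = s ^ 2) : ∃ g k : ℤ, p ^ 2 = g ^ 4 ∧ q ^ 2 = k ^ 4 := by
  obtain ⟨g, hg⟩ := Int.sq_of_gcd_eq_one (Int.isCoprime_iff_gcd_eq_one.mp hpq) h
  obtain ⟨k, hk⟩ := Int.sq_of_gcd_eq_one (Int.isCoprime_iff_gcd_eq_one.mp hpq.symm)
    ((mul_comm q p).trans h)
  refine ⟨g, k, ?_, ?_⟩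
  · rcases hg with rfl | rfl <;> ring
  · rcases hk with rfl | rfl <;> ring

/-- The descent step for `x ^ 4 + 4 * y ^ 4 = z ^ 2` with `x` odd and coprime to `y`. -/
theorem Int.exists_smaller_pow_four_add_four_mul_pow_four {x y z : ℤ} (hy : y ≠ 0)
    (hz : 0 < z) (hxy : IsCoprime x y) (hx : x % 2 = 1) (h : x ^ 4 + 4 * y ^ 4 = z ^ 2) :
    ∃ u v r : ℤ, u ≠ 0 ∧ v ≠ 0 ∧ 0 < r ∧ r < z ∧ u ^ 4 + 4 * v ^ 4 = r ^ 2 := by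
  have hx2 : IsCoprime x 2 := by
    refine ⟨1, -(x / 2), ?_⟩
    omega
  have hcop : Int.gcd (x ^ 2) (2 * y ^ 2) = 1 :=
    Int.isCoprime_iff_gcd_eq_one.mp (IsCoprime.pow_left (hx2.mul_right hxy.pow_right))
  have hxsq : x ^ 2 % 4 = 1 := by
    obtain ⟨j, rfl⟩ : ∃ j, x = 2 * j + 1 := ⟨x / 2, by omega⟩
    ring_nf
    omega
  have hT : PythagoreanTriple (x ^ 2) (2 * y ^ 2) z := by
    unfold PythagoreanTriple
    linear_combination h
  obtain ⟨m, n, hm, hn, hzmn, hmn, hpar, hm0⟩ :=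
    hT.coprime_classification' hcop (by omega) hz
  have hymn : m * n = y ^ 2 := by linarith
  have hysq : 0 < y ^ 2 := by positivity
  have hmpos : 0 < m := by
    rcases hm0.eq_or_lt with h0 | h0
    · rw [← h0] at hymn
      omega
    · exact h0
  have hnpos : 0 < n := by
    refine pos_of_mul_pos_right ?_ hm0
    rw [hymn]
    exact hysq
  have hmodd : m % 2 = 1 ∧ n % 2 = 0 := by
    refine hpar.symm.resolve_right ?_
    rintro ⟨h1, h2⟩
    obtain ⟨i, rfl⟩ : ∃ i, m = 2 * i := ⟨m / 2, by omega⟩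
    obtain ⟨j, rfl⟩ : ∃ j, n = 2 * j + 1 := ⟨n / 2, by omega⟩
    ring_nf at hm hxsq
    omega
  obtain ⟨r, hr⟩ := Int.sq_of_gcd_eq_one hmn hymn
  obtain ⟨s, hs⟩ := Int.sq_of_gcd_eq_one (Int.gcd_comm m n ▸ hmn) ((mul_comm n m).trans hymn)
  replace hr : m = r ^ 2 := hr.resolve_right fun h' => by nlinarith [sq_nonneg r]
  replace hs : n = s ^ 2 := hs.resolve_right fun h' => by nlinarith [sq_nonneg s]
  have hmn' : IsCoprime m n := Int.isCoprime_iff_gcd_eq_one.mpr hmn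
  have hxn : IsCoprime x n := by
    have h1 : IsCoprime (m ^ 2 + n * (-n)) n := (hmn'.pow_left (m := 2)).add_mul_left_left (-n)
    rw [show m ^ 2 + n * (-n) = x ^ 2 by rw [hm]; ring] at h1
    exact (IsCoprime.pow_left_iff two_pos).mp h1
  have hT' : PythagoreanTriple x n m := by
    unfold PythagoreanTriple
    linear_combination hm
  obtain ⟨p, q, -, hq, hmpq, hpq, hpar', -⟩ :=
    hT'.coprime_classification' (Int.isCoprime_iff_gcd_eq_one.mp hxn) hx hmpos
  have hpq' : IsCoprime p q := Int.isCoprime_iff_gcd_eq_one.mpr hpq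
  obtain ⟨t, rfl⟩ : ∃ t, s = 2 * t := by
    have : (2 : ℤ) ∣ s ^ 2 := by omega
    exact Int.prime_two.dvd_of_dvd_pow this
  have key : ∃ u v : ℤ, IsCoprime u v ∧ u * v = t ^ 2 ∧ u ^ 2 + 4 * v ^ 2 = m := by
    rcases hpar' with ⟨h1, h2⟩ | ⟨h1, h2⟩
    · obtain ⟨i, rfl⟩ : ∃ i, p = 2 * i := ⟨p / 2, by omega⟩
      exact ⟨q, i, (IsCoprime.of_mul_left_right hpq').symm, by linarith, by linarith⟩
    · obtain ⟨i, rfl⟩ : ∃ i, q = 2 * i := ⟨q / 2, by omega⟩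
      exact ⟨p, i, IsCoprime.of_mul_right_right hpq', by linarith, by linarith⟩
  obtain ⟨u, v, huv, hut, huvm⟩ := key
  have ht : t ≠ 0 := by
    rintro rfl
    simp at hs
    omega
  have huv0 : u * v ≠ 0 := hut ▸ pow_ne_zero 2 ht
  obtain ⟨g, k, hg, hk⟩ := Int.exists_sq_eq_pow_four_of_mul_eq_sq huv hut
  refine ⟨g, k, |r|, ?_, ?_, ?_, ?_, ?_⟩
  · rintro rfl
    exact huv0 (by simp_all)
  · rintro rfl
    exact huv0 (by simp_all)
  · rw [abs_pos]
    rintro rfl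
    simp at hr
    omega
  · have h1 : |r| ≤ m := by
      rw [hr]
      rw [← sq_abs r]
      exact Int.le_self_sq |r|
    nlinarith
  · rw [sq_abs, ← hr, ← hg, ← hk, huvm]

/-- The equation `x ^ 4 + 4 * y ^ 4 = z ^ 2` has no integer solutions with `x * y ≠ 0`. -/
theorem Int.pow_four_add_four_mul_pow_four_ne_sq {x y z : ℤ} (hx : x ≠ 0) (hy : y ≠ 0) :
    x ^ 4 + 4 * y ^ 4 ≠ z ^ 2 := by
  suffices H : ∀ (n : ℕ) (x y z : ℤ), x ≠ 0 → y ≠ 0 → 0 < z → z.toNat = n →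
      x ^ 4 + 4 * y ^ 4 ≠ z ^ 2 by
    intro h
    have hz : z ≠ 0 := by
      rintro rfl
      have : 0 < x ^ 4 + 4 * y ^ 4 := by positivity
      omega
    exact H _ x y |z| hx hy (abs_pos.mpr hz) rfl (by rw [sq_abs, h])
  intro n
  induction n using Nat.strong_induction_on with
  | _ n ih =>
  intro x y z hx hy hz hzn h
  have descend : ∀ u v r : ℤ, u ≠ 0 → v ≠ 0 → 0 < r → r < z → u ^ 4 + 4 * v ^ 4 ≠ r ^ 2 :=
    fun u v r hu hv hr hrz => ih r.toNat (by omega) u v r hu hv hr rfl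
  by_cases hg : Int.gcd x y = 1
  · have hcop : IsCoprime x y := Int.isCoprime_iff_gcd_eq_one.mpr hg
    rcases Int.emod_two_eq_zero_or_one x with hx2 | hx2
    · obtain ⟨i, rfl⟩ : ∃ i, x = 2 * i := ⟨x / 2, by omega⟩
      obtain ⟨w, rfl⟩ : (2 : ℤ) ∣ z :=
        Int.prime_two.dvd_of_dvd_pow (n := 2) ⟨8 * i ^ 4 + 2 * y ^ 4, by rw [← h]; ring⟩
      exact descend y i w hy (by rintro rfl; simp at hx) (by omega) (by omega) (by linarith)
    · obtain ⟨u, v, r, hu, hv, hr, hrz, huvr⟩ :=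
        Int.exists_smaller_pow_four_add_four_mul_pow_four hy hz hcop hx2 h
      exact descend u v r hu hv hr hrz huvr
  · have hd0 : 0 < Int.gcd x y := Int.gcd_pos_of_ne_zero_left y hx
    obtain ⟨i, hi⟩ := Int.gcd_dvd_left x y
    obtain ⟨j, hj⟩ := Int.gcd_dvd_right x y
    have hd : (1 : ℤ) < Int.gcd x y := by omega
    generalize (Int.gcd x y : ℤ) = d at hi hj hd
    subst hi hj
    obtain ⟨w, rfl⟩ : d ^ 2 ∣ z := by
      rw [← Int.pow_dvd_pow_iff two_ne_zero]
      exact ⟨i ^ 4 + 4 * j ^ 4, by rw [← h]; ring⟩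
    have hw : 0 < w := pos_of_mul_pos_right hz (by positivity)
    refine descend i j w (right_ne_zero_of_mul hx) (right_ne_zero_of_mul hy) hw
      (lt_mul_of_one_lt_left hw (one_lt_pow₀ hd two_ne_zero)) ?_
    have hd4 : d ^ 4 ≠ 0 := by positivity
    apply mul_left_cancel₀ hd4
    linear_combination h

/-- On a midline of a square with integer side length, no point has integer distances
to all four vertices. -/
theorem no_point_on_midline (a y : ℤ) (ha : 0 < a) (hy0 : 0 ≤ y) (hy : y ≤ 2 * a) :
    ¬ (IsSq (a ^ 2 + y ^ 2) ∧ IsSq (a ^ 2 + (2 * a - y) ^ 2)) := by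
  rintro ⟨⟨b, hb⟩, ⟨c, hc⟩⟩
  rcases eq_or_ne y a with rfl | hya
  · have hbsq : (b : ℝ) ^ 2 = 2 * (y : ℝ) ^ 2 := by
      have : b ^ 2 = 2 * y ^ 2 := by linarith
      exact_mod_cast this
    have hy' : (0 : ℝ) < y := by exact_mod_cast ha
    apply irrational_sqrt_two
    refine ⟨|(b : ℚ)| / y, ?_⟩
    push_cast
    rw [eq_comm, Real.sqrt_eq_iff_eq_sq (by norm_num) (by positivity), div_pow, sq_abs, hbsq]
    field_simp
  · refine Int.pow_four_add_four_mul_pow_four_ne_sq (x := y - a) (y := a) (z := b * c)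
      (sub_ne_zero.mpr hya) ha.ne' ?_
    rw [mul_pow, ← hb, ← hc]
    ring
end

section
/- If (x, y, z) is an admissible configuration, then z is even and exactly one of x and y is odd (in particular, the point P does not lie on a diagonal of the square). -/
/-- `(x, y, z)` is an admissible configuration: `P = (x, y)` is an interior point of the
square with vertices `(0,0), (z,0), (0,z), (z,z)`, with `gcd(x, y, z) = 1`, and the four
squared distances from `P` to the vertices are all perfect squares. -/
def Admissible (x y z : ℤ) : Prop :=
  0 < x ∧ x < z ∧ 0 < y ∧ y < z ∧ Int.gcd x (Int.gcd y z) = 1 ∧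
  IsSq (x ^ 2 + y ^ 2) ∧ IsSq (x ^ 2 + (z - y) ^ 2) ∧
  IsSq ((z - x) ^ 2 + y ^ 2) ∧ IsSq ((z - x) ^ 2 + (z - y) ^ 2)

/-- A sum of two odd squares is `2` modulo `4`, hence not a square. -/
theorem not_isSq_sq_add_sq_of_odd {a b : ℤ} (ha : Odd a) (hb : Odd b) :
    ¬ IsSq (a ^ 2 + b ^ 2) := by
  rintro ⟨w, hw⟩
  have h₁ := Int.sq_mod_four_eq_one_of_odd ha
  have h₂ := Int.sq_mod_four_eq_one_of_odd hb
  rcases Int.even_or_odd w with ⟨k, rfl⟩ | h₃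
  · have : (k + k) ^ 2 = 4 * k ^ 2 := by ring
    omega
  · have := Int.sq_mod_four_eq_one_of_odd h₃
    omega

/-- In an admissible configuration, `z` is even and exactly one of `x` and `y` is odd
(in particular `x ≠ y`, so `P` is not on a diagonal). -/
theorem parity_of_admissible (x y z : ℤ) (h : Admissible x y z) :
    Even z ∧ Xor' (Odd x) (Odd y) := by
  obtain ⟨-, -, -, -, hgcd, h₁, h₂, h₃, h₄⟩ := h
  have hxy : ¬ (Odd x ∧ Odd y) := fun h => not_isSq_sq_add_sq_of_odd h.1 h.2 h₁
  have hz : Even z := by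
    by_contra hz
    rw [Int.not_even_iff_odd] at hz
    rcases Int.even_or_odd x with hx | hx <;> rcases Int.even_or_odd y with hy | hy
    · exact not_isSq_sq_add_sq_of_odd (hz.sub_even hx) (hz.sub_even hy) h₄
    · exact not_isSq_sq_add_sq_of_odd (hz.sub_even hx) hy h₃
    · exact not_isSq_sq_add_sq_of_odd hx (hz.sub_even hy) h₂
    · exact hxy ⟨hx, hy⟩
  have hodd : Odd x ∨ Odd y := by
    by_contra! h
    simp only [Int.not_odd_iff_even] at h
    have hdvd : (2 : ℤ) ∣ Int.gcd x (Int.gcd y z) :=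
      Int.dvd_coe_gcd h.1.two_dvd (Int.dvd_coe_gcd h.2.two_dvd hz.two_dvd)
    rw [hgcd] at hdvd
    norm_num at hdvd
  exact ⟨hz, xor_iff_or_and_not_and _ _ |>.mpr ⟨hodd, hxy⟩⟩
end

section
/- If (x, y, z) is an admissible configuration and y is even, then x is odd and y is divisible by 4. -/
/-- The even leg of an integer right triangle with an odd leg is divisible by `4`. -/
theorem four_dvd_of_isSq_sq_add_sq {a b : ℤ} (ha : Odd a) (hb : Even b)
    (h : IsSq (a ^ 2 + b ^ 2)) : 4 ∣ b := by
  obtain ⟨w, hw⟩ := h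
  have hw_odd : Odd w := by
    have : Odd (w ^ 2) := hw ▸ ha.pow.add_even (hb.pow_of_ne_zero two_ne_zero)
    exact Int.Odd.of_mul_left (sq w ▸ this)
  have h₁ := Int.eight_dvd_sq_sub_one_of_odd ha
  have h₂ := Int.eight_dvd_sq_sub_one_of_odd hw_odd
  obtain ⟨c, rfl⟩ := hb.two_dvd
  rcases Int.even_or_odd' c with ⟨k, rfl | rfl⟩
  · exact ⟨k, by ring⟩
  · ring_nf at hw h₁ h₂
    omega

/-- In an admissible configuration with `y` even, `x` is odd and `4 ∣ y`. -/
theorem odd_x_and_four_dvd_y (x y z : ℤ) (h : Admissible x y z) (hy : Even y) :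
    Odd x ∧ 4 ∣ y := by
  obtain ⟨-, -, -, -, hgcd, h₁, -, -, h₄⟩ := h
  suffices hx : Odd x from ⟨hx, four_dvd_of_isSq_sq_add_sq hx hy h₁⟩
  by_contra hx
  rw [Int.not_odd_iff_even] at hx
  have hz : Odd z := by
    by_contra hz
    rw [Int.not_odd_iff_even] at hz
    have h2 : 2 ∣ Int.gcd x (Int.gcd y z) :=
      Int.dvd_gcd hx.two_dvd
        (Int.natCast_dvd_natCast.mpr (Int.dvd_gcd hy.two_dvd hz.two_dvd))
    omega
  exact not_isSq_sq_add_sq_of_odd (hz.sub_even hx) (hz.sub_even hy) h₄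
end

section
/- If (x, y, z) is an admissible configuration, then z is divisible by 12. -/
/-- One of two integers whose squares sum to a perfect square is divisible by `3`. -/
theorem IsSq.three_dvd_or {x y : ℤ} (h : IsSq (x ^ 2 + y ^ 2)) : 3 ∣ x ∨ 3 ∣ y := by
  obtain ⟨w, hw⟩ := h
  have key : ∀ x y w : ZMod 3, x ^ 2 + y ^ 2 = w ^ 2 → x = 0 ∨ y = 0 := by decide
  have hw' := congrArg (Int.cast : ℤ → ZMod 3) hw
  push_cast at hw'
  exact (key x y w hw').imp (ZMod.intCast_zmod_eq_zero_iff_dvd x 3).1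
    (ZMod.intCast_zmod_eq_zero_iff_dvd y 3).1

/-- In a Pythagorean triple, a leg is divisible by `4` whenever the other leg is odd. -/
theorem IsSq.four_dvd_or_two_dvd {x y : ℤ} (h : IsSq (x ^ 2 + y ^ 2)) : 4 ∣ x ∨ 2 ∣ y := by
  obtain ⟨w, hw⟩ := h
  have key : ∀ x y w : ZMod 8, x ^ 2 + y ^ 2 = w ^ 2 → 2 * x = 0 ∨ 4 * y = 0 := by decide
  have hw' := congrArg (Int.cast : ℤ → ZMod 8) hw
  push_cast at hw'
  refine (key x y w hw').imp (fun hx => ?_) (fun hy => ?_)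
  · have : (8 : ℤ) ∣ 2 * x := (ZMod.intCast_zmod_eq_zero_iff_dvd _ 8).1 (by exact_mod_cast hx)
    omega
  · have : (8 : ℤ) ∣ 4 * y := (ZMod.intCast_zmod_eq_zero_iff_dvd _ 8).1 (by exact_mod_cast hy)
    omega

/-- In an admissible configuration, `z` is divisible by `12`. -/
theorem twelve_dvd_z (x y z : ℤ) (h : Admissible x y z) : 12 ∣ z := by
  obtain ⟨-, -, -, -, hgcd, h₁, h₂, h₃, h₄⟩ := h
  have three_dvd : 3 ∣ z := by
    have := h₁.three_dvd_or
    have := h₂.three_dvd_or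
    have := h₃.three_dvd_or
    have := h₄.three_dvd_or
    omega
  have not_all_even : ¬ (2 ∣ x ∧ 2 ∣ y ∧ 2 ∣ z) := by
    rintro ⟨hx, hy, hz⟩
    have := Int.dvd_coe_gcd hx (Int.dvd_coe_gcd hy hz)
    rw [hgcd] at this
    omega
  have four_dvd : 4 ∣ z := by
    have := h₁.four_dvd_or_two_dvd
    have := h₂.four_dvd_or_two_dvd
    have := h₃.four_dvd_or_two_dvd
    have := h₄.four_dvd_or_two_dvd
    rw [add_comm] at h₁ h₂ h₃ h₄
    have := h₁.four_dvd_or_two_dvd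
    have := h₂.four_dvd_or_two_dvd
    have := h₃.four_dvd_or_two_dvd
    have := h₄.four_dvd_or_two_dvd
    omega
  omega
end

section
/- If (x, y, z) is an admissible configuration, then all eight of the following inequalities hold: x² ≥ 2y+1, y² ≥ 2x+1, (z−x)² ≥ 2y+1, y² ≥ 2(z−x)+1, x² ≥ 2(z−y)+1, (z−y)² ≥ 2x+1, (z−x)² ≥ 2(z−y)+1, and (z−y)² ≥ 2(z−x)+1. -/
/-- If a leg `a` is nonzero and the other leg `b` is nonnegative, an integral hypotenuse
exceeds `b` by at least one. -/
theorem IsSq.two_mul_add_one_le_sq {a b : ℤ} (h : IsSq (a ^ 2 + b ^ 2)) (ha : a ≠ 0)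
    (hb : 0 ≤ b) : 2 * b + 1 ≤ a ^ 2 := by
  obtain ⟨w, hw⟩ := h
  have hlt : b < |w| := lt_of_pow_lt_pow_left₀ 2 (abs_nonneg w) (by
    rw [sq_abs, ← hw]
    exact lt_add_of_pos_left _ (sq_pos_of_ne_zero ha))
  nlinarith [sq_abs w]

/-- The eight inequalities of Theorem 1. -/
theorem eight_inequalities (x y z : ℤ) (h : Admissible x y z) :
    x ^ 2 ≥ 2 * y + 1 ∧ y ^ 2 ≥ 2 * x + 1 ∧
    (z - x) ^ 2 ≥ 2 * y + 1 ∧ y ^ 2 ≥ 2 * (z - x) + 1 ∧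
    x ^ 2 ≥ 2 * (z - y) + 1 ∧ (z - y) ^ 2 ≥ 2 * x + 1 ∧
    (z - x) ^ 2 ≥ 2 * (z - y) + 1 ∧ (z - y) ^ 2 ≥ 2 * (z - x) + 1 := by
  obtain ⟨hx, hxz, hy, hyz, -, h₁, h₂, h₃, h₄⟩ := h
  have hx' : 0 < z - x := sub_pos.mpr hxz
  have hy' : 0 < z - y := sub_pos.mpr hyz
  have legs {a b : ℤ} (ha : 0 < a) (hb : 0 < b) (h : IsSq (a ^ 2 + b ^ 2)) :
      a ^ 2 ≥ 2 * b + 1 ∧ b ^ 2 ≥ 2 * a + 1 :=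
    ⟨h.two_mul_add_one_le_sq ha.ne' hb.le,
      IsSq.two_mul_add_one_le_sq (add_comm (a ^ 2) _ ▸ h) hb.ne' ha.le⟩
  exact ⟨(legs hx hy h₁).1, (legs hx hy h₁).2, (legs hx' hy h₃).1, (legs hx' hy h₃).2,
    (legs hx hy' h₂).1, (legs hx hy' h₂).2, (legs hx' hy' h₄).1, (legs hx' hy' h₄).2⟩
end

section
/- Let (x, y, z) be an admissible configuration, and let p be an odd prime such that 2 is a quadratic non-residue modulo p. Then x ≢ y (mod p), x ≢ z−y (mod p), z−x ≢ y (mod p), and z−x ≢ z−y (mod p). -/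
/-- If `2` is not a square modulo the prime `p`, then `u ^ 2 + v ^ 2` with `u ≡ v` modulo `p`
can only be a perfect square when `p` divides `u`. -/
lemma dvd_of_modEq_of_isSq_add {p : ℕ} (hp : p.Prime)
    (hnr : ¬ ∃ w : ℤ, w ^ 2 ≡ 2 [ZMOD (p : ℤ)]) {u v : ℤ} (huv : u ≡ v [ZMOD (p : ℤ)])
    (hsq : IsSq (u ^ 2 + v ^ 2)) : (p : ℤ) ∣ u := by
  have := Fact.mk hp
  obtain ⟨w, hw⟩ := hsq
  by_contra hu
  have hu0 : (u : ZMod p) ≠ 0 := fun h => hu ((ZMod.intCast_zmod_eq_zero_iff_dvd u p).mp h)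
  have huv' : (u : ZMod p) = v := (ZMod.intCast_eq_intCast_iff u v p).mpr huv
  have hw' : (u : ZMod p) ^ 2 + (v : ZMod p) ^ 2 = (w : ZMod p) ^ 2 := by
    exact_mod_cast congrArg (Int.cast : ℤ → ZMod p) hw
  obtain ⟨t, ht⟩ := ZMod.intCast_surjective ((w : ZMod p) / (u : ZMod p))
  refine hnr ⟨t, (ZMod.intCast_eq_intCast_iff _ _ p).mp ?_⟩
  push_cast
  rw [ht, div_pow, ← hw', ← huv']
  field_simp
  norm_num

/-- Theorem 2: for an odd prime `p` modulo which `2` is a quadratic non-residue,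
none of the four congruences `x ≡ y`, `x ≡ z - y`, `z - x ≡ y`, `z - x ≡ z - y`
modulo `p` can hold in an admissible configuration. -/
theorem not_congruent_mod_nonresidue_prime (x y z : ℤ) (h : Admissible x y z)
    (p : ℕ) (hp : p.Prime) (hodd : Odd p)
    (hnr : ¬ ∃ w : ℤ, w ^ 2 ≡ 2 [ZMOD (p : ℤ)]) :
    ¬ x ≡ y [ZMOD (p : ℤ)] ∧ ¬ x ≡ z - y [ZMOD (p : ℤ)] ∧
    ¬ z - x ≡ y [ZMOD (p : ℤ)] ∧ ¬ z - x ≡ z - y [ZMOD (p : ℤ)] := by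
  obtain ⟨-, -, -, -, hgcd, h₁, h₂, h₃, h₄⟩ := h
  have not_dvd : (p : ℤ) ∣ x → (p : ℤ) ∣ y → (p : ℤ) ∣ z → False := fun hx hy hz => by
    have hdvd : (p : ℤ) ∣ (Int.gcd x (Int.gcd y z) : ℤ) :=
      Int.dvd_coe_gcd hx (Int.dvd_coe_gcd hy hz)
    rw [hgcd] at hdvd
    exact hp.one_lt.ne' (Nat.dvd_one.mp (Int.natCast_dvd_natCast.mp hdvd))
  have hxy : ¬ x ≡ y [ZMOD (p : ℤ)] := fun hc => by
    have hx := dvd_of_modEq_of_isSq_add hp hnr hc h₁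
    have hzx := dvd_of_modEq_of_isSq_add hp hnr ((Int.ModEq.refl z).sub hc) h₄
    exact not_dvd hx (hc.dvd_iff.mp hx) ((dvd_sub_left hx).mp hzx)
  have hxzy : ¬ x ≡ z - y [ZMOD (p : ℤ)] := fun hc => by
    have hx := dvd_of_modEq_of_isSq_add hp hnr hc h₂
    have hc' : z - x ≡ y [ZMOD (p : ℤ)] := by
      simpa using (Int.ModEq.refl z).sub hc
    have hzx := dvd_of_modEq_of_isSq_add hp hnr hc' h₃
    exact not_dvd hx (hc'.dvd_iff.mp hzx) ((dvd_sub_left hx).mp hzx)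
  refine ⟨hxy, hxzy, fun hc => hxzy ?_, fun hc => hxy ?_⟩
  · simpa using (Int.ModEq.refl z).sub hc
  · simpa using (Int.ModEq.refl z).sub hc
end

section
/- Let (x, y, z) be an admissible configuration with x odd (and hence y even). Then x is not a prime number and z − x is not a prime number. -/
/-- `s ^ 4 + 4 * y ^ 4` is never a square for coprime `s`, `y` with `s` odd and `y` nonzero. -/
theorem pow_four_add_four_mul_pow_four_ne_sq (s y w : ℤ) (hs : s % 2 = 1) (hy : y ≠ 0)
    (hsy : IsCoprime s y) : s ^ 4 + 4 * y ^ 4 ≠ w ^ 2 := by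
  induction hn : y.natAbs using Nat.strong_induction_on generalizing s y w with
  | _ n ih =>
  subst hn
  intro h
  have sq_odd : ∀ t : ℤ, t % 2 = 1 → (t ^ 2) % 2 = 1 := fun t ht => by
    rw [← Int.odd_iff] at ht ⊢; exact ht.pow
  have hs2 : IsCoprime s 2 := ⟨1, -(s / 2), by omega⟩
  have hy2 : 0 < y ^ 2 := by positivity
  have hw0 : w ≠ 0 := by
    rintro rfl
    nlinarith [sq_nonneg (s ^ 2), pow_pos hy2 2]
  have htriple : PythagoreanTriple (s ^ 2) (2 * y ^ 2) |w| := by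
    unfold PythagoreanTriple
    rw [abs_mul_abs_self]; linarith
  obtain ⟨m, n, hm1, hm2, -, hmn, -, hm0⟩ := htriple.coprime_classification'
    (Int.isCoprime_iff_gcd_eq_one.1 (hs2.pow_left.mul_right hsy.pow)) (sq_odd s hs) (by positivity)
  have hmny : m * n = y ^ 2 := by linarith
  have hmpos : 0 < m := lt_of_le_of_ne hm0 (by rintro rfl; simp at hmny; omega)
  have hnpos : 0 < n := pos_of_mul_pos_right (hmny ▸ hy2) hm0
  obtain ⟨a, ha⟩ := Int.sq_of_gcd_eq_one hmn hmny
  obtain ⟨b, hb⟩ := Int.sq_of_gcd_eq_one (Int.gcd_comm m n ▸ hmn) (mul_comm m n ▸ hmny)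
  replace ha : m = a ^ 2 := ha.resolve_right (by nlinarith [sq_nonneg a])
  replace hb : n = b ^ 2 := hb.resolve_right (by nlinarith [sq_nonneg b])
  subst ha hb
  have ha0 : a ≠ 0 := by rintro rfl; simp at hmpos
  have htriple' : PythagoreanTriple s (b ^ 2) (a ^ 2) := by
    unfold PythagoreanTriple; linarith
  have hsb : IsCoprime s (b ^ 2) := by
    refine IsCoprime.of_isCoprime_of_dvd_right (hsy.pow_right (n := 2)) ?_
    exact ⟨a ^ 2, by linarith⟩
  obtain ⟨k, l, -, hkl, hkla, hgcd, hpar, -⟩ := htriple'.coprime_classification'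
    (Int.isCoprime_iff_gcd_eq_one.1 hsb) hs hmpos
  have descend : ∀ k l : ℤ, b ^ 2 = 2 * (2 * k) * l → a ^ 2 = (2 * k) ^ 2 + l ^ 2 →
      IsCoprime (2 * k) l → l % 2 = 1 → False := by
    intro k l hkl hkla hcop hl
    obtain ⟨c, rfl⟩ : 2 ∣ b :=
      Int.prime_two.dvd_of_dvd_pow (n := 2) ⟨2 * k * l, by linarith⟩
    have hklc : k * l = c ^ 2 := by linarith
    have hgcd : Int.gcd k l = 1 := Int.isCoprime_iff_gcd_eq_one.1 hcop.of_mul_left_right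
    have hc0 : 0 < c ^ 2 := by linarith
    have hrt : ∃ r t : ℤ, k ^ 2 = r ^ 4 ∧ l ^ 2 = t ^ 4 ∧ r ∣ k ∧ t ∣ l := by
      obtain ⟨r, hr⟩ := Int.sq_of_gcd_eq_one hgcd hklc
      obtain ⟨t, ht⟩ := Int.sq_of_gcd_eq_one (Int.gcd_comm k l ▸ hgcd) (mul_comm k l ▸ hklc)
      refine ⟨r, t, ?_, ?_, ?_, ?_⟩
      · rcases hr with rfl | rfl <;> ring
      · rcases ht with rfl | rfl <;> ring
      · rcases hr with rfl | rfl <;> simp [pow_two]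
      · rcases ht with rfl | rfl <;> simp [pow_two]
    obtain ⟨r, t, hr, ht, hrk, htl⟩ := hrt
    have hk0 : k ≠ 0 := by rintro rfl; simp at hklc; omega
    have hr0 : r ≠ 0 := by rintro rfl; exact hk0 (zero_dvd_iff.1 hrk)
    have ht1 : t % 2 = 1 := by
      obtain ⟨q, rfl⟩ := htl
      exact Int.odd_iff.1 (Int.odd_mul.1 (Int.odd_iff.2 hl)).1
    have hl0 : l ≠ 0 := by rintro rfl; simp at hl
    have hrk' : r ^ 2 ≤ |k| := by
      rw [← abs_of_nonneg (sq_nonneg r)]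
      exact sq_le_sq.1 (by linarith [hr])
    have hrc : r ^ 2 ≤ c ^ 2 := by
      have : |k| * |l| = c ^ 2 := by rw [← abs_mul, hklc, abs_of_pos hc0]
      have := abs_nonneg k
      have := Int.one_le_abs hl0
      nlinarith
    have hlt : r ^ 2 < y ^ 2 := by
      have : 1 ≤ a ^ 2 := hmpos
      nlinarith
    refine ih r.natAbs (Int.natAbs_lt_iff_sq_lt.2 hlt) t r a ht1 hr0 ?_ rfl (by linarith)
    exact (hcop.of_mul_left_right.of_isCoprime_of_dvd_left hrk).of_isCoprime_of_dvd_right htl |>.symm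
  have hcop := Int.isCoprime_iff_gcd_eq_one.2 hgcd
  rcases hpar with ⟨hk, hl⟩ | ⟨hk, hl⟩
  · obtain ⟨k, rfl⟩ := Int.dvd_of_emod_eq_zero hk
    exact descend k l hkl hkla hcop hl
  · obtain ⟨l, rfl⟩ := Int.dvd_of_emod_eq_zero hl
    exact descend l k (by linarith) (by linarith) hcop.symm hk

/-- A right triangle with prime leg `p` has other leg `(p ^ 2 - 1) / 2`. -/
theorem IsSq.two_mul_eq_of_prime {p y : ℤ} (hp : Prime p) (hp0 : 0 < p) (hy : 0 < y)
    (h : IsSq (p ^ 2 + y ^ 2)) : 2 * y = p ^ 2 - 1 := by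
  obtain ⟨w, hw⟩ := h
  have hw' : (|w| - y) * (|w| + y) = p ^ 2 := by linarith [sq_abs w]
  have hsum : 0 < |w| + y := by positivity
  have hdiff : 0 < |w| - y := by
    by_contra! hneg
    nlinarith
  obtain ⟨i, hi, hassoc⟩ := (dvd_prime_pow hp 2).1 (Dvd.intro _ hw')
  have heq : |w| - y = p ^ i := by
    have := pow_pos hp0 i
    rcases Int.associated_iff.1 hassoc with h | h <;> omega
  rw [heq] at hw'
  interval_cases i
  · linarith
  · nlinarith
  · nlinarith

/-- A point on the midline of a square of side `2 * y`, at odd distance `p` from a side with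
`2 * y = p ^ 2 - 1`, does not have integer distances to all vertices. -/
theorem not_isSq_of_two_mul_eq {p y : ℤ} (hp : Odd p) (hy : 0 < y) (hyp : 2 * y = p ^ 2 - 1)
    (h₁ : IsSq (p ^ 2 + y ^ 2)) : ¬ IsSq ((2 * y - p) ^ 2 + y ^ 2) := by
  rintro ⟨v, hv⟩
  obtain ⟨u, hu⟩ := h₁
  have hodd : (y - p) % 2 = 1 := by
    obtain ⟨k, rfl⟩ := hp
    have : y = 2 * (k * (k + 1)) := by linarith
    omega
  have hcop : IsCoprime (y - p) y := ⟨-(p + y), y - 2, by linarith⟩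
  refine pow_four_add_four_mul_pow_four_ne_sq (y - p) y (u * v) hodd hy.ne' hcop ?_
  rw [mul_pow, ← hu, ← hv]
  ring

/-- Theorem 3: in an admissible configuration with `x` odd, neither `x` nor `z - x`
is a prime number. -/
theorem x_not_prime (x y z : ℤ) (h : Admissible x y z) (hx : Odd x) :
    ¬ Prime x ∧ ¬ Prime (z - x) := by
  obtain ⟨hx0, hxz, hy0, hyz, -, h₁, h₂, h₃, h₄⟩ := h
  constructor
  · intro hp
    have hy := h₁.two_mul_eq_of_prime hp hx0 hy0
    have hz := h₂.two_mul_eq_of_prime hp hx0 (by omega)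
    obtain rfl : z = 2 * y := by linarith
    exact not_isSq_of_two_mul_eq hx hy0 hy h₁ h₃
  · intro hp
    have hy := h₃.two_mul_eq_of_prime hp (by omega) hy0
    have hz := h₄.two_mul_eq_of_prime hp (by omega) (by omega)
    obtain rfl : z = 2 * y := by linarith
    refine not_isSq_of_two_mul_eq ((even_two_mul y).sub_odd hx) hy0 hy h₃ ?_
    rwa [sub_sub_cancel]
end

section
/- Let (x, y, z) be an admissible configuration with x odd (and hence y even), and let p be an odd prime such that 2 is a quadratic non-residue modulo p. Then for every positive integer n, x ≠ pⁿ and z − x ≠ pⁿ. -/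
/-- A positive factor of a square that is coprime to its cofactor is a square. -/
theorem exists_pos_sq_of_isCoprime {a b c : ℤ} (ha : 0 < a) (hab : IsCoprime a b)
    (h : a * b = c ^ 2) : ∃ r, 0 < r ∧ a = r ^ 2 := by
  obtain ⟨r, hr | hr⟩ := Int.sq_of_isCoprime hab h
  · refine ⟨|r|, abs_pos.mpr ?_, by rw [sq_abs, hr]⟩
    rintro rfl
    simp [hr] at ha
  · nlinarith [sq_nonneg r]

/-- If the congruum `m * n * (m ^ 2 - n ^ 2)` of coprime integers of opposite parity is a square,
then so is each of its factors. -/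
theorem exists_sq_of_congruum_sq {m n k : ℤ} (hn : 0 < n) (hlt : n < m) (hcmn : IsCoprime m n)
    (hodd : Odd (m + n)) (hk : m * (n * ((m + n) * (m - n))) = k ^ 2) :
    ∃ G F E H : ℤ, 0 < G ∧ 0 < F ∧ 0 < E ∧ 0 < H ∧
      m = G ^ 2 ∧ n = F ^ 2 ∧ m + n = E ^ 2 ∧ m - n = H ^ 2 := by
  have hm_add : IsCoprime m (m + n) := by simpa [add_comm] using hcmn.add_mul_left_right 1
  have hn_add : IsCoprime n (m + n) := by simpa using hcmn.symm.add_mul_left_right 1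
  have hm_sub : IsCoprime m (m - n) := by
    have := hcmn.neg_right.add_mul_left_right 1
    rwa [mul_one, neg_add_eq_sub] at this
  have hn_sub : IsCoprime n (m - n) := by
    have := hcmn.symm.add_mul_left_right (-1)
    rwa [mul_neg_one, ← sub_eq_add_neg] at this
  have hadd_sub : IsCoprime (m + n) (m - n) := by
    have htwo : IsCoprime (m + n) 2 := by
      obtain ⟨t, ht⟩ := hodd
      exact ⟨1, -t, by rw [ht]; ring⟩
    have := (htwo.mul_right hm_add.symm).add_mul_left_right (-1)
    rwa [show 2 * m + (m + n) * -1 = m - n by ring] at this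
  obtain ⟨G, hG, hmG⟩ := exists_pos_sq_of_isCoprime (hn.trans hlt) (hcmn.mul_right (hm_add.mul_right hm_sub)) hk
  obtain ⟨F, hF, hnF⟩ := exists_pos_sq_of_isCoprime hn (hcmn.symm.mul_right (hn_add.mul_right hn_sub))
    (c := k) (by rw [← hk]; ring)
  obtain ⟨E, hE, hE'⟩ := exists_pos_sq_of_isCoprime (a := m + n) (by linarith)
    (hadd_sub.mul_right (hm_add.symm.mul_right hn_add.symm)) (c := k) (by rw [← hk]; ring)
  obtain ⟨H, hH, hH'⟩ := exists_pos_sq_of_isCoprime (a := m - n) (by linarith)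
    (hadd_sub.symm.mul_right (hm_sub.symm.mul_right hn_sub.symm)) (c := k) (by rw [← hk]; ring)
  exact ⟨G, F, E, H, hG, hF, hE, hH, hmG, hnF, hE', hH'⟩

/-- The inductive step of Fermat's descent for `no_concordant`: the sum and difference of the
squares of coprime `g` and `f` being squares yields a smaller solution. -/
theorem concordant_descent {g f e h : ℤ} (hg : 0 < g) (hf : 0 < f) (he : 0 < e) (hh : 0 < h)
    (hgf : IsCoprime g f) (hadd : g ^ 2 + f ^ 2 = e ^ 2) (hsub : g ^ 2 - f ^ 2 = h ^ 2) :
    ∃ g' f' e' h' : ℤ, 0 < g' ∧ 0 < f' ∧ 0 < e' ∧ 0 < h' ∧ g' < g ∧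
      g' ^ 2 + f' ^ 2 = e' ^ 2 ∧ g' ^ 2 - f' ^ 2 = h' ^ 2 := by
  have hsum : e ^ 2 + h ^ 2 = 2 * g ^ 2 := by linarith
  have hpar : Even (e + h) := by
    have : Even (e ^ 2 + h ^ 2) := ⟨g ^ 2, by linarith⟩
    simpa [Int.even_add, Int.even_pow] using this
  obtain ⟨u, hu⟩ := hpar
  obtain ⟨v, rfl⟩ : ∃ v, e = u + v := ⟨e - u, by ring⟩
  obtain rfl : h = u - v := by linarith
  have hlegs : u * u + v * v = g * g := by linarith
  have harea : 2 * (u * v) = f ^ 2 := by linarith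
  have hu0 : 0 < u := by linarith
  have hv0 : 0 < v := by
    have : 0 < u * v := by linarith [pow_pos hf 2]
    exact pos_of_mul_pos_right this hu0.le
  have hcop : Int.gcd u v = 1 := by
    rw [← Int.isCoprime_iff_gcd_eq_one]
    refine isCoprime_of_prime_dvd (by rintro ⟨rfl, -⟩; exact lt_irrefl _ hu0) ?_
    intro k hk hku hkv
    have hkg : k ∣ g := hk.dvd_of_dvd_pow (n := 2) (by
      rw [sq, ← hlegs]; exact dvd_add (hku.mul_right u) (hkv.mul_right v))
    have hkf : k ∣ f := hk.dvd_of_dvd_pow (n := 2) (by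
      rw [← harea]; exact (hku.mul_right v).mul_left 2)
    exact hk.not_isUnit (hgf.isUnit_of_dvd' hkg hkf)
  obtain ⟨m₀, n₀, hmn₀, hz₀, hc₀, hp₀⟩ :=
    PythagoreanTriple.coprime_classification.mp ⟨hlegs, hcop⟩
  obtain ⟨m, n, hm0, hprod, hz, hc, hp⟩ : ∃ m n : ℤ, 0 ≤ m ∧
      ((u = m ^ 2 - n ^ 2 ∧ v = 2 * m * n) ∨ (u = 2 * m * n ∧ v = m ^ 2 - n ^ 2)) ∧
      g = m ^ 2 + n ^ 2 ∧ Int.gcd m n = 1 ∧ (m + n) % 2 = 1 := by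
    have hz : g = m₀ ^ 2 + n₀ ^ 2 := by
      rcases hz₀ with hz | hz
      · exact hz
      · linarith [sq_nonneg m₀, sq_nonneg n₀]
    rcases le_total 0 m₀ with hm | hm
    · exact ⟨m₀, n₀, hm, hmn₀, hz, hc₀, by omega⟩
    · refine ⟨-m₀, -n₀, by linarith, ?_, by rw [hz]; ring, by simpa using hc₀, by omega⟩
      simpa using hmn₀
  have hmn : 0 < m * n ∧ 0 < m ^ 2 - n ^ 2 := by
    rcases hprod with ⟨h1, h2⟩ | ⟨h1, h2⟩ <;> constructor <;> linarith
  have hm : 0 < m := lt_of_le_of_ne hm0 (by rintro rfl; simp at hmn)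
  have hn : 0 < n := pos_of_mul_pos_right hmn.1 hm0
  have hlt : n < m := lt_of_pow_lt_pow_left₀ 2 hm0 (by linarith)
  have harea' : f ^ 2 = 4 * (m * n * (m ^ 2 - n ^ 2)) := by
    rcases hprod with ⟨h1, h2⟩ | ⟨h1, h2⟩ <;> rw [← harea, h1, h2] <;> ring
  obtain ⟨k, rfl⟩ : (2 : ℤ) ∣ f :=
    Int.prime_two.dvd_of_dvd_pow (n := 2) ⟨2 * (m * n * (m ^ 2 - n ^ 2)), by rw [harea']; ring⟩
  have hk : m * (n * ((m + n) * (m - n))) = k ^ 2 := by linarith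
  have hcmn : IsCoprime m n := Int.isCoprime_iff_gcd_eq_one.mpr hc
  have hodd : Odd (m + n) := Int.odd_iff.mpr hp
  obtain ⟨G, F, E, H, hG, hF, hE, hH, hmG, hnF, hE', hH'⟩ :=
    exists_sq_of_congruum_sq hn hlt hcmn hodd hk
  refine ⟨G, F, E, H, hG, hF, hE, hH, ?_, by linarith, by linarith⟩
  calc G ≤ G ^ 2 := le_self_pow₀ (by omega) two_ne_zero
    _ = m := hmG.symm
    _ ≤ m ^ 2 := le_self_pow₀ (by omega) two_ne_zero
    _ < g := by rw [hz]; linarith [pow_pos hn 2]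

/-- Fermat: `g ^ 2 + f ^ 2` and `g ^ 2 - f ^ 2` are not both squares for nonzero `f`. -/
theorem no_concordant {g f e h : ℤ} (hf : f ≠ 0) (hadd : g ^ 2 + f ^ 2 = e ^ 2)
    (hsub : g ^ 2 - f ^ 2 = h ^ 2) : False := by
  induction hN : g.natAbs using Nat.strong_induction_on generalizing g f e h with
  | _ N ih =>
    have hg : g ≠ 0 := by
      rintro rfl
      have : 0 < f ^ 2 := by positivity
      nlinarith [sq_nonneg h]
    by_cases hcop : IsCoprime g f
    · have he : e ≠ 0 := by
        rintro rfl
        have : 0 < f ^ 2 := by positivity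
        nlinarith [sq_nonneg g]
      have hh : h ≠ 0 := by
        rintro rfl
        have hgf : g ^ 2 = f ^ 2 := by linarith
        have hu : IsUnit (g ^ 2) := (hcop.pow (m := 2) (n := 2)).isUnit_of_dvd' dvd_rfl hgf.dvd
        have hg1 : g ^ 2 = 1 := by
          rcases Int.isUnit_iff.mp hu with h1 | h1
          · exact h1
          · nlinarith [sq_nonneg g]
        have he2 : e ^ 2 = 2 := by linarith
        have h1 : e < 2 := by nlinarith
        have h2 : -2 < e := by nlinarith
        interval_cases e <;> simp at he2
      obtain ⟨g', f', e', h', hg', hf', -, -, hlt, hadd', hsub'⟩ :=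
        concordant_descent (abs_pos.mpr hg) (abs_pos.mpr hf) (abs_pos.mpr he) (abs_pos.mpr hh)
          (IsCoprime.abs_abs hcop) (by simpa using hadd) (by simpa using hsub)
      rw [Int.abs_eq_natAbs] at hlt
      exact ih g'.natAbs (by omega) hf'.ne' hadd' hsub' rfl
    · obtain ⟨k, hk, ⟨g', rfl⟩, f', rfl⟩ : ∃ k : ℤ, Prime k ∧ k ∣ g ∧ k ∣ f := by
        by_contra! hcon
        exact hcop (isCoprime_of_prime_dvd (fun H => hg H.1) hcon)
      obtain ⟨e', rfl⟩ : k ∣ e := by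
        refine hk.dvd_of_dvd_pow (n := 2) ⟨k * (g' ^ 2 + f' ^ 2), ?_⟩
        rw [← hadd]; ring
      obtain ⟨h', rfl⟩ : k ∣ h := by
        refine hk.dvd_of_dvd_pow (n := 2) ⟨k * (g' ^ 2 - f' ^ 2), ?_⟩
        rw [← hsub]; ring
      have hk2 : k ^ 2 ≠ 0 := pow_ne_zero 2 hk.ne_zero
      refine ih g'.natAbs ?_ (right_ne_zero_of_mul hf) (e := e') (h := h')
        (mul_left_cancel₀ hk2 (by linarith)) (mul_left_cancel₀ hk2 (by linarith)) rfl
      rw [← hN, Int.natAbs_mul]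
      have h1 := (Int.prime_iff_natAbs_prime.mp hk).two_le
      have h2 := Int.natAbs_pos.mpr (right_ne_zero_of_mul hg)
      nlinarith

/-- A point on the midline `z = 2 * y` at integer distance from the four vertices lies on a
side or at the centre. -/
theorem eq_of_midline {x y a c : ℤ} (hy : y ≠ 0) (ha : x ^ 2 + y ^ 2 = a ^ 2)
    (hc : (2 * y - x) ^ 2 + y ^ 2 = c ^ 2) : y = x := by
  by_contra hne
  refine no_concordant (g := 2 * a * c * y) (f := (a ^ 2 - c ^ 2) * y)
    (e := (a ^ 2 + c ^ 2) * y) (h := (a ^ 2 - c ^ 2) * x - 2 * a ^ 2 * y)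
    (mul_ne_zero ?_ hy) (by ring) ?_
  · have : a ^ 2 - c ^ 2 = 4 * y * (x - y) := by rw [← ha, ← hc]; ring
    rw [this]
    exact mul_ne_zero (mul_ne_zero four_ne_zero hy) (sub_ne_zero.mpr (Ne.symm hne))
  · have : (2 * a * c * y) ^ 2 = 4 * a ^ 2 * c ^ 2 * y ^ 2 := by ring
    rw [this, ← ha, ← hc]
    ring

/-- In a Pythagorean triple with one leg an odd prime power `p ^ n` and the other leg `y`
coprime to `p`, the leg `y` is determined. -/
theorem two_mul_leg_eq {p n : ℕ} (hp : p.Prime) (hodd : Odd p) {y : ℤ} (hy : 0 < y)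
    (hpy : ¬ (p : ℤ) ∣ y) (hsq : IsSq (((p : ℤ) ^ n) ^ 2 + y ^ 2)) :
    2 * y = ((p : ℤ) ^ n) ^ 2 - 1 := by
  obtain ⟨w, hw⟩ := hsq
  obtain ⟨a, ha0, ha⟩ : ∃ a : ℤ, 0 ≤ a ∧ ((p : ℤ) ^ n) ^ 2 + y ^ 2 = a ^ 2 :=
    ⟨|w|, abs_nonneg w, by rw [hw, sq_abs]⟩
  have hpp : Prime (p : ℤ) := Nat.prime_iff_prime_int.mp hp
  have hfac : ((p : ℤ) ^ n) ^ 2 = (a - y) * (a + y) := by linarith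
  have hpos : 0 < ((p : ℤ) ^ n) ^ 2 := by have := hp.pos; positivity
  have unit_of {b : ℤ} (hb : ¬ (p : ℤ) ∣ b) (hdvd : b ∣ ((p : ℤ) ^ n) ^ 2) : IsUnit b :=
    ((((Prime.coprime_iff_not_dvd hpp).mpr hb).symm.pow_right (n := n)).pow_right
      (n := 2)).isUnit_of_dvd' dvd_rfl hdvd
  have hsum : 0 < a + y := by linarith
  have hdiff : 0 < a - y := by
    rw [hfac] at hpos
    exact pos_of_mul_pos_left hpos hsum.le
  by_cases h1 : (p : ℤ) ∣ a - y
  · have h2 : ¬ (p : ℤ) ∣ a + y := by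
      intro h2
      have h3 : (p : ℤ) ∣ 2 * y := by
        have := dvd_sub h2 h1
        ring_nf at this ⊢
        exact this
      rcases hpp.dvd_or_dvd h3 with h4 | h4
      · have h5 : p ∣ 2 := by exact_mod_cast h4
        rw [(Nat.prime_dvd_prime_iff_eq hp Nat.prime_two).mp h5] at hodd
        exact absurd hodd (by decide)
      · exact hpy h4
    have := Int.isUnit_iff.mp (unit_of h2 ⟨a - y, by rw [hfac]; ring⟩)
    omega
  · have h2 : a - y = 1 := by
      have := Int.isUnit_iff.mp (unit_of h1 ⟨a + y, hfac⟩)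
      omega
    rw [hfac, h2]
    linarith

/-- If `p ∤ y`, no point with first coordinate `p ^ n` has integer distances to the vertices. -/
theorem false_of_eq_prime_pow_of_not_dvd {p n : ℕ} (hp : p.Prime) (hodd : Odd p)
    (hnr : ¬ ∃ w : ℤ, w ^ 2 ≡ 2 [ZMOD (p : ℤ)]) (hn : 0 < n) {x y z : ℤ} (hx : x = (p : ℤ) ^ n)
    (hy : 0 < y) (hyz : y < z) (hpy : ¬ (p : ℤ) ∣ y) (h₁ : IsSq (x ^ 2 + y ^ 2))
    (h₂ : IsSq (x ^ 2 + (z - y) ^ 2)) (h₃ : IsSq ((z - x) ^ 2 + y ^ 2)) : False := by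
  have hpx : (p : ℤ) ∣ x := hx ▸ dvd_pow_self _ hn.ne'
  have hy2 : 2 * y = x ^ 2 - 1 := by
    rw [hx] at h₁ ⊢
    exact two_mul_leg_eq hp hodd hy hpy h₁
  by_cases hpz : (p : ℤ) ∣ z - y
  · obtain ⟨c, hc⟩ := h₃
    refine hnr ⟨2 * c, (Int.modEq_iff_dvd.mpr ?_).symm⟩
    obtain ⟨s, hs⟩ := hpx
    obtain ⟨t, ht⟩ := hpz
    obtain rfl : z = y + p * t := by linarith
    have hc' : (2 * c) ^ 2 - 2 = 2 * ((2 * y) ^ 2 - 1) +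
        4 * (p * t - x) * (2 * y + p * t - x) := by
      rw [mul_pow, ← hc]; ring
    rw [hc', hy2, hs]
    exact ⟨2 * s * (p * s) * ((p * s) ^ 2 - 2) + 4 * (t - s) * (x ^ 2 - 1 + p * t - p * s),
      by rw [hs]; ring⟩
  · have hz2 : 2 * (z - y) = x ^ 2 - 1 := by
      rw [hx] at h₂ ⊢
      exact two_mul_leg_eq hp hodd (by linarith) hpz h₂
    obtain rfl : z = 2 * y := by linarith
    obtain ⟨a, ha⟩ := h₁
    obtain ⟨c, hc⟩ := h₃
    exact hpy (eq_of_midline hy.ne' ha hc ▸ hpx)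

/-- No point with first coordinate `p ^ n` has integer distances to the vertices, unless `p`
divides both `y` and `z`. -/
theorem false_of_eq_prime_pow {p n : ℕ} (hp : p.Prime) (hodd : Odd p)
    (hnr : ¬ ∃ w : ℤ, w ^ 2 ≡ 2 [ZMOD (p : ℤ)]) (hn : 0 < n) {x y z : ℤ} (hx : x = (p : ℤ) ^ n)
    (hy : 0 < y) (hyz : y < z) (hpyz : ¬ ((p : ℤ) ∣ y ∧ (p : ℤ) ∣ z))
    (h₁ : IsSq (x ^ 2 + y ^ 2)) (h₂ : IsSq (x ^ 2 + (z - y) ^ 2))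
    (h₃ : IsSq ((z - x) ^ 2 + y ^ 2)) (h₄ : IsSq ((z - x) ^ 2 + (z - y) ^ 2)) : False := by
  by_cases hpy : (p : ℤ) ∣ y
  · refine false_of_eq_prime_pow_of_not_dvd hp hodd hnr hn hx (sub_pos.mpr hyz)
      (sub_lt_self z hy) (fun h => hpyz ⟨hpy, ?_⟩) h₂ (by rwa [sub_sub_cancel]) h₄
    exact (dvd_sub_left hpy).mp h
  · exact false_of_eq_prime_pow_of_not_dvd hp hodd hnr hn hx hy hyz hpy h₁ h₂ h₃

/-- Theorem 4: for an odd prime `p` modulo which `2` is a quadratic non-residue,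
neither `x` nor `z - x` is a positive power of `p`. -/
theorem x_not_prime_power (x y z : ℤ) (h : Admissible x y z) (hx : Odd x)
    (p : ℕ) (hp : p.Prime) (hodd : Odd p)
    (hnr : ¬ ∃ w : ℤ, w ^ 2 ≡ 2 [ZMOD (p : ℤ)]) :
    ∀ n : ℕ, 0 < n → x ≠ (p : ℤ) ^ n ∧ z - x ≠ (p : ℤ) ^ n := by
  obtain ⟨-, -, hy, hyz, hgcd, h₁, h₂, h₃, h₄⟩ := h
  have hndvd (hpx : (p : ℤ) ∣ x) : ¬ ((p : ℤ) ∣ y ∧ (p : ℤ) ∣ z) := by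
    rintro ⟨hpy, hpz⟩
    have hdvd := Int.dvd_coe_gcd hpx (Int.dvd_coe_gcd hpy hpz)
    rw [hgcd] at hdvd
    exact hp.one_lt.ne' (Nat.dvd_one.mp (by exact_mod_cast hdvd))
  intro n hn
  refine ⟨fun hxp => ?_, fun hxp => ?_⟩
  · exact false_of_eq_prime_pow hp hodd hnr hn hxp hy hyz
      (hndvd (hxp ▸ dvd_pow_self _ hn.ne')) h₁ h₂ h₃ h₄
  · refine false_of_eq_prime_pow hp hodd hnr hn hxp hy hyz (fun h => ?_) h₃ h₄
      (by rwa [sub_sub_cancel]) (by rwa [sub_sub_cancel])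
    have hpzx : (p : ℤ) ∣ z - x := hxp ▸ dvd_pow_self _ hn.ne'
    exact hndvd ((dvd_sub_right h.2).mp hpzx) h
end

section
/- Let (x, y, z) be an admissible configuration with x odd and y even. Let p₁, …, p_j be odd primes, each of which either satisfies p_i ≡ 1 (mod 4) or is such that 2 is a quadratic non-residue modulo p_i, and let h, l₁, …, l_j be positive integers with 2ʰ > p₁^{l₁} p₂^{l₂} ⋯ p_j^{l_j}. Then y ≠ 2^{h+1} p₁^{l₁} p₂^{l₂} ⋯ p_j^{l_j} and z − y ≠ 2^{h+1} p₁^{l₁} p₂^{l₂} ⋯ p_j^{l_j}. -/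
/-- If `c * d = n ^ 2` with `c` odd and no prime `q ≡ 3 [MOD 4]` divides both factors, then `c` is a
sum of two squares, hence `c ≡ 1 [MOD 4]`. -/
lemma mod_four_eq_one_of_mul_eq_sq {c d n : ℕ} (hc : Odd c) (hn : n ≠ 0) (hcd : c * d = n ^ 2)
    (hq : ∀ q : ℕ, q.Prime → q % 4 = 3 → q ∣ c → ¬ q ∣ d) : c % 4 = 1 := by
  have hcd0 : c * d ≠ 0 := hcd ▸ pow_ne_zero 2 hn
  have hsum : ∃ a b : ℕ, c = a ^ 2 + b ^ 2 := by
    rw [Nat.eq_sq_add_sq_iff]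
    intro q hqc hq3
    have hqp := Nat.prime_of_mem_primeFactors hqc
    have : Fact q.Prime := ⟨hqp⟩
    have hval : padicValNat q (c * d) = padicValNat q (n ^ 2) := by rw [hcd]
    rw [padicValNat.mul (left_ne_zero_of_mul hcd0) (right_ne_zero_of_mul hcd0),
      padicValNat.pow, padicValNat.eq_zero_of_not_dvd
        (hq q hqp hq3 (Nat.dvd_of_mem_primeFactors hqc)), add_zero] at hval
    rw [hval]
    exact even_two_mul _
  obtain ⟨a, b, rfl⟩ := hsum
  have ha : a ^ 2 % 4 = 0 ∨ a ^ 2 % 4 = 1 := by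
    rcases Nat.even_or_odd' a with ⟨k, rfl | rfl⟩ <;> ring_nf <;> omega
  have hb : b ^ 2 % 4 = 0 ∨ b ^ 2 % 4 = 1 := by
    rcases Nat.even_or_odd' b with ⟨k, rfl | rfl⟩ <;> ring_nf <;> omega
  rw [Nat.odd_iff] at hc
  omega

/-- A positive odd leg `x` whose other leg is `2 ^ (h + 1) * n`, with `n < 2 ^ h` odd, is `3` modulo
`4` as soon as it shares no prime factor `q ≡ 3 [MOD 4]` with `n`. -/
lemma leg_emod_four_eq_three {x : ℤ} {n h : ℕ} (hx : Odd x) (hx0 : 0 < x) (hn : Odd n)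
    (hh : 0 < h) (hlt : n < 2 ^ h)
    (hq : ∀ q : ℕ, q.Prime → q % 4 = 3 → q ∣ n → ¬ (q : ℤ) ∣ x)
    (hsq : IsSq (x ^ 2 + (2 ^ (h + 1) * (n : ℤ)) ^ 2)) : x % 4 = 3 := by
  obtain ⟨a, ha⟩ := hsq
  wlog ha0 : 0 ≤ a generalizing a
  · exact this (-a) (by rw [ha]; ring) (by omega)
  have hn0 : n ≠ 0 := hn.pos.ne'
  have hprod : 0 < (2 ^ (h + 1) * (n : ℤ)) ^ 2 := by positivity
  have hxa : x < a := by nlinarith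
  have ha_odd : Odd a := by
    have : Odd (a ^ 2) := by
      rw [← ha]
      exact hx.pow.add_even ⟨2 * (2 ^ h * (n : ℤ)) ^ 2, by ring⟩
    exact Int.Odd.of_mul_left (by rwa [sq] at this)
  obtain ⟨s, hs⟩ : ∃ s : ℕ, a - x = 2 * s := by
    obtain ⟨k, hk⟩ := ha_odd.sub_odd hx
    exact ⟨k.toNat, by omega⟩
  obtain ⟨t, ht⟩ : ∃ t : ℕ, a + x = 2 * t := by
    obtain ⟨k, hk⟩ := ha_odd.add_odd hx
    exact ⟨k.toNat, by omega⟩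
  have hxts : x = t - s := by omega
  have hst : s * t = 2 ^ (2 * h) * n ^ 2 := by
    have : (4 : ℤ) * (s * t) = 4 * (2 ^ (2 * h) * n ^ 2) := by
      calc (4 : ℤ) * (s * t) = (2 * s) * (2 * t) := by ring
        _ = a ^ 2 - x ^ 2 := by rw [← hs, ← ht]; ring
        _ = 4 * (2 ^ (2 * h) * n ^ 2) := by rw [← ha]; ring
    exact_mod_cast mul_left_cancel₀ (by norm_num) this
  have hpow : 0 < 2 ^ (2 * h) := by positivity
  have hqst : ∀ q : ℕ, q.Prime → q % 4 = 3 → q ∣ n → q ∣ s → ¬ q ∣ t := by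
    intro q hqp hq3 hqn hqs hqt
    refine hq q hqp hq3 hqn ?_
    rw [hxts]
    exact dvd_sub (Int.natCast_dvd_natCast.2 hqt) (Int.natCast_dvd_natCast.2 hqs)
  rcases Nat.even_or_odd s with hse | hso
  · have hto : Odd t := by
      rw [Int.odd_iff] at ha_odd
      rw [Nat.even_iff] at hse
      rw [Nat.odd_iff]
      omega
    obtain ⟨d, rfl⟩ : 2 ^ (2 * h) ∣ s :=
      ((Nat.coprime_two_left.2 hto).pow_left _).dvd_of_dvd_mul_right ⟨_, hst⟩
    rw [mul_assoc] at hst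
    have hdt : d * t = n ^ 2 := Nat.eq_of_mul_eq_mul_left hpow hst
    have hd : 0 < d := Nat.pos_of_ne_zero (left_ne_zero_of_mul (hdt ▸ pow_ne_zero 2 hn0))
    have htn : t ≤ n ^ 2 := by nlinarith
    have hnn : n ^ 2 < 2 ^ (2 * h) := by
      rw [mul_comm, pow_mul]
      exact Nat.pow_lt_pow_left hlt two_ne_zero
    have : 2 ^ (2 * h) ≤ 2 ^ (2 * h) * d := Nat.le_mul_of_pos_right _ hd
    omega
  · obtain ⟨d, rfl⟩ : 2 ^ (2 * h) ∣ t :=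
      ((Nat.coprime_two_left.2 hso).pow_left _).dvd_of_dvd_mul_left ⟨_, hst⟩
    rw [mul_left_comm] at hst
    have hsd : s * d = n ^ 2 := Nat.eq_of_mul_eq_mul_left hpow hst
    have hs1 : s % 4 = 1 := mod_four_eq_one_of_mul_eq_sq hso hn0 hsd fun q hqp hq3 hqs hqd =>
      hqst q hqp hq3 (hqp.dvd_of_dvd_pow (hsd ▸ hqs.mul_right d)) hqs (hqd.mul_left _)
    have h4 : 4 ∣ 2 ^ (2 * h) * d :=
      (pow_dvd_pow 2 (show 2 ≤ 2 * h by omega)).mul_right d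
    omega

/-- If a prime `q` divides `a` and `b` but not `z`, and `(z - a) ^ 2 + (z - b) ^ 2` is a square,
then `2` is a quadratic residue modulo `q`. -/
lemma exists_sq_modEq_two {q : ℕ} (hq : q.Prime) {a b z : ℤ} (ha : (q : ℤ) ∣ a)
    (hb : (q : ℤ) ∣ b) (hz : ¬ (q : ℤ) ∣ z) (hsq : IsSq ((z - a) ^ 2 + (z - b) ^ 2)) :
    ∃ w : ℤ, w ^ 2 ≡ 2 [ZMOD (q : ℤ)] := by
  have : Fact q.Prime := ⟨hq⟩
  obtain ⟨w, hw⟩ := hsq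
  have ha' : (a : ZMod q) = 0 := (ZMod.intCast_zmod_eq_zero_iff_dvd a q).2 ha
  have hb' : (b : ZMod q) = 0 := (ZMod.intCast_zmod_eq_zero_iff_dvd b q).2 hb
  have hz' : (z : ZMod q) ≠ 0 := fun h0 => hz ((ZMod.intCast_zmod_eq_zero_iff_dvd z q).1 h0)
  have hw' := congrArg (Int.cast : ℤ → ZMod q) hw
  push_cast at hw'
  rw [ha', hb', sub_zero] at hw'
  obtain ⟨v, hv⟩ := ZMod.intCast_surjective ((w : ZMod q) / (z : ZMod q))
  refine ⟨v, (ZMod.intCast_eq_intCast_iff _ _ q).1 ?_⟩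
  push_cast
  rw [hv, div_pow, ← hw']
  field_simp
  norm_num

lemma IsSq.four_dvd_of_odd_of_even {a b : ℤ} (ha : Odd a) (hb : Even b)
    (hsq : IsSq (a ^ 2 + b ^ 2)) : 4 ∣ b := by
  obtain ⟨w, hw⟩ := hsq
  have hw_odd : Odd w := by
    have : Odd (w ^ 2) := hw ▸ ha.pow.add_even (hb.pow_of_ne_zero two_ne_zero)
    exact Int.Odd.of_mul_left (by rwa [sq] at this)
  have h1 := Int.eight_dvd_sq_sub_one_of_odd ha
  have h2 := Int.eight_dvd_sq_sub_one_of_odd hw_odd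
  obtain ⟨k, rfl⟩ := hb
  rcases Int.even_or_odd' k with ⟨m, rfl | rfl⟩
  · exact ⟨m, by ring⟩
  · exfalso
    ring_nf at *
    omega

lemma Admissible.even_side {x y z : ℤ} (hadm : Admissible x y z) (hx : Odd x) (hy : Even y) :
    Even z := by
  obtain ⟨-, -, -, -, -, -, ⟨w, hw⟩, -, -⟩ := hadm
  by_contra hz
  have h1 := Int.sq_mod_four_eq_one_of_odd hx
  have h2 := Int.sq_mod_four_eq_one_of_odd ((Int.not_even_iff_odd.1 hz).sub_even hy)
  rcases Int.even_or_odd' w with ⟨k, rfl | rfl⟩ <;> ring_nf at * <;> omega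

lemma Admissible.reflect {x y z : ℤ} (hadm : Admissible x y z) : Admissible x (z - y) z := by
  obtain ⟨h1, h2, h3, h4, h5, h6, h7, h8, h9⟩ := hadm
  refine ⟨h1, h2, by omega, by omega, ?_, h7, by simpa using h6, h9, by simpa using h8⟩
  rwa [Int.gcd_self_sub_left]

/-- The main theorem for one odd number `n` in place of the product of prime powers. -/
lemma Admissible.ne_two_pow_mul {x y z : ℤ} (hadm : Admissible x y z) (hx : Odd x) (hy : Even y)
    {n h : ℕ} (hn : Odd n) (hh : 0 < h) (hlt : n < 2 ^ h)
    (hq : ∀ q : ℕ, q.Prime → q % 4 = 3 → q ∣ n → ¬ ∃ w : ℤ, w ^ 2 ≡ 2 [ZMOD (q : ℤ)]) :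
    y ≠ 2 ^ (h + 1) * (n : ℤ) := by
  intro hyn
  have hz : Even z := hadm.even_side hx hy
  obtain ⟨hx0, hxz, -, -, hgcd, hxy, hxy', hxy'', hxy'''⟩ := hadm
  have hy4 : 4 ∣ y := hxy.four_dvd_of_odd_of_even hx hy
  have hzy4 : 4 ∣ z - y := hxy'.four_dvd_of_odd_of_even hx (hz.sub hy)
  have hqy : ∀ q : ℕ, q ∣ n → (q : ℤ) ∣ y := fun q hqn =>
    hyn ▸ (Int.natCast_dvd_natCast.2 hqn).mul_left _
  have hcop : ∀ q : ℕ, q.Prime → q ∣ n → (q : ℤ) ∣ x → ¬ (q : ℤ) ∣ z := by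
    intro q hqp hqn hqx hqz
    have h1 := Int.dvd_coe_gcd hqx (Int.dvd_coe_gcd (hqy q hqn) hqz)
    rw [hgcd] at h1
    exact hqp.one_lt.ne' (Nat.dvd_one.1 (Int.natCast_dvd_natCast.1 h1))
  have hx3 : x % 4 = 3 := leg_emod_four_eq_three hx hx0 hn hh hlt
    (fun q hqp hq3 hqn hqx => hq q hqp hq3 hqn
      (exists_sq_modEq_two hqp hqx (hqy q hqn) (hcop q hqp hqn hqx) hxy''')) (hyn ▸ hxy)
  have hu3 : (z - x) % 4 = 3 := leg_emod_four_eq_three (hz.sub_odd hx) (by omega) hn hh hlt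
    (fun q hqp hq3 hqn hqu => hq q hqp hq3 hqn
      (exists_sq_modEq_two hqp hqu (hqy q hqn)
        (fun hqz => hcop q hqp hqn ((dvd_sub_right hqz).1 hqu) hqz)
        (by simpa using hxy'))) (hyn ▸ hxy'')
  omega

/-- Theorem 5: with `p₁, …, p_j` odd primes each congruent to `1` mod `4` or modulo
which `2` is a quadratic non-residue, and positive integers `h, l₁, …, l_j` with
`2 ^ h > ∏ pᵢ ^ lᵢ`, neither `y` nor `z - y` equals `2 ^ (h + 1) * ∏ pᵢ ^ lᵢ`. -/
theorem y_not_special_form (x y z : ℤ) (hadm : Admissible x y z)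
    (hx : Odd x) (hy : Even y)
    (j : ℕ) (p l : Fin j → ℕ)
    (hp : ∀ i, (p i).Prime) (hpodd : ∀ i, Odd (p i))
    (hcond : ∀ i, p i % 4 = 1 ∨ ¬ ∃ w : ℤ, w ^ 2 ≡ 2 [ZMOD ((p i : ℤ))])
    (h : ℕ) (hh : 0 < h) (hl : ∀ i, 0 < l i)
    (hlt : ∏ i, p i ^ l i < 2 ^ h) :
    y ≠ 2 ^ (h + 1) * ∏ i, (p i : ℤ) ^ l i ∧
    z - y ≠ 2 ^ (h + 1) * ∏ i, (p i : ℤ) ^ l i := by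
  have hz : Even z := hadm.even_side hx hy
  have hn : Odd (∏ i, p i ^ l i) :=
    Finset.prod_induction _ Odd (fun _ _ => Odd.mul) odd_one fun i _ => (hpodd i).pow
  have hq : ∀ q : ℕ, q.Prime → q % 4 = 3 → q ∣ ∏ i, p i ^ l i →
      ¬ ∃ w : ℤ, w ^ 2 ≡ 2 [ZMOD (q : ℤ)] := by
    intro q hqp hq3 hqn
    obtain ⟨i, -, hi⟩ := (hqp.prime.dvd_finsetProd_iff _).1 hqn
    obtain rfl : q = p i := (Nat.prime_dvd_prime_iff_eq hqp (hp i)).1 (hqp.dvd_of_dvd_pow hi)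
    exact (hcond i).resolve_left (by omega)
  have h1 := hadm.ne_two_pow_mul hx hy hn hh hlt hq
  have h2 := hadm.reflect.ne_two_pow_mul hx (hz.sub hy) hn hh hlt hq
  push_cast at h1 h2
  exact ⟨h1, h2⟩
end

section
/- Let (x, y, z) be an admissible configuration with x odd and y even. Then for every positive integer h, y ≠ 2^{h+1} and z − y ≠ 2^{h+1}; that is, neither y nor z − y is a power of 2 greater than or equal to 4. -/
/-- In a Pythagorean triple with odd first leg, the second leg is divisible by `4`. -/
theorem four_dvd_of_isSq_add_sq {x w : ℤ} (hx : Odd x) (h : IsSq (x ^ 2 + w ^ 2)) : 4 ∣ w := by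
  obtain ⟨a, ha⟩ := h
  obtain ⟨k, rfl⟩ := hx
  have key : ∀ k r s : ZMod 8, (2 * k + 1) ^ 2 + r ^ 2 = s ^ 2 → r = 0 ∨ r = 4 := by decide
  have hcast : (2 * (k : ZMod 8) + 1) ^ 2 + (w : ZMod 8) ^ 2 = (a : ZMod 8) ^ 2 := by
    exact_mod_cast congrArg (Int.cast : ℤ → ZMod 8) ha
  rcases key _ _ _ hcast with h0 | h4
  · have := (ZMod.intCast_zmod_eq_zero_iff_dvd w 8).1 h0
    omega
  · have := (ZMod.intCast_eq_intCast_iff w 4 8).1 (by exact_mod_cast h4)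
    unfold Int.ModEq at this
    omega

/-- A positive odd divisor of a power of two is `1`. -/
theorem eq_one_of_odd_of_dvd_two_pow {p : ℤ} {n : ℕ} (hpos : 0 < p) (hp : Odd p)
    (hdvd : p ∣ 2 ^ n) : p = 1 := by
  have hcop : IsCoprime p (2 ^ n) := (Int.isCoprime_two_right.2 hp).pow_right
  have hunit : IsUnit p := hcop.isUnit_of_dvd' dvd_rfl hdvd
  rcases Int.isUnit_iff.1 hunit with h | h <;> omega

/-- The odd leg of a Pythagorean triple whose even leg is `2 ^ (h + 1)` is `2 ^ (2 * h) - 1`. -/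
theorem odd_leg_eq_of_even_leg_two_pow {x : ℤ} {h : ℕ} (hpos : 0 < x) (hx : Odd x)
    (hsq : IsSq (x ^ 2 + (2 ^ (h + 1)) ^ 2)) : x = 2 ^ (2 * h) - 1 := by
  obtain ⟨b, hb⟩ := hsq
  obtain ⟨a, ha0, ha⟩ : ∃ a : ℤ, 0 ≤ a ∧ x ^ 2 + (2 ^ (h + 1)) ^ 2 = a ^ 2 :=
    ⟨|b|, abs_nonneg b, by rw [sq_abs, hb]⟩
  have hpow : ((2 : ℤ) ^ (h + 1)) ^ 2 = 4 * 2 ^ (2 * h) := by ring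
  rw [hpow] at ha
  have hN : (0 : ℤ) < 2 ^ (2 * h) := by positivity
  have hlt : x < a := by nlinarith
  have ha_odd : Odd a := by
    have : Odd (a ^ 2) := by
      rw [← ha]
      exact hx.pow.add_even ⟨2 * 2 ^ (2 * h), by ring⟩
    exact (Int.odd_pow' two_ne_zero).1 this
  obtain ⟨p, hp⟩ : ∃ p, a - x = 2 * p := (ha_odd.sub_odd hx).two_dvd
  have hprod : p * (p + x) = 2 ^ (2 * h) := by
    obtain rfl : a = x + 2 * p := by linarith
    linarith
  have hp_pos : 0 < p := by linarith
  rcases Int.even_or_odd p with hpe | hpo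
  · have := eq_one_of_odd_of_dvd_two_pow (by linarith) (hpe.add_odd hx)
      (Dvd.intro_left p hprod)
    linarith
  · obtain rfl := eq_one_of_odd_of_dvd_two_pow hp_pos hpo (Dvd.intro _ hprod)
    linarith

/-- For odd `x` and `u`, two Pythagorean triples sharing the leg `2 ^ (h + 1)` force
`x = u`, and hence `x + u` is not divisible by `4`. -/
theorem not_four_dvd_add_of_common_leg_two_pow {x u : ℤ} {h : ℕ} (hx0 : 0 < x) (hu0 : 0 < u)
    (hx : Odd x) (hu : Odd u) (hxy : IsSq (x ^ 2 + (2 ^ (h + 1)) ^ 2))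
    (huy : IsSq (u ^ 2 + (2 ^ (h + 1)) ^ 2)) : ¬ 4 ∣ x + u := by
  have hxu : x = u := (odd_leg_eq_of_even_leg_two_pow hx0 hx hxy).trans
    (odd_leg_eq_of_even_leg_two_pow hu0 hu huy).symm
  obtain ⟨k, hk⟩ := hx
  omega

/-- Corollary 5.1: neither `y` nor `z - y` is a power of `2` that is at least `4`. -/
theorem y_not_power_of_two (x y z : ℤ) (hadm : Admissible x y z)
    (hx : Odd x) (hy : Even y) :
    ∀ h : ℕ, 0 < h → y ≠ 2 ^ (h + 1) ∧ z - y ≠ 2 ^ (h + 1) := by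
  intro h _
  obtain ⟨hx0, hxz, -, -, -, hxy, hxw, huy, huw⟩ := hadm
  have hy4 : 4 ∣ y := four_dvd_of_isSq_add_sq hx hxy
  have hw4 : 4 ∣ z - y := four_dvd_of_isSq_add_sq hx hxw
  have hz4 : 4 ∣ x + (z - x) := by omega
  have hu : Odd (z - x) := by
    obtain ⟨k, hk⟩ := hx
    exact Int.odd_iff.2 (by omega)
  constructor <;> intro heq
  · rw [heq] at hxy huy
    exact not_four_dvd_add_of_common_leg_two_pow hx0 (sub_pos.2 hxz) hx hu hxy huy hz4
  · rw [heq] at hxw huw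
    exact not_four_dvd_add_of_common_leg_two_pow hx0 (sub_pos.2 hxz) hx hu hxw huw hz4
end

section
/- Let (x, y, z) be an admissible configuration with x odd and y even. Let q₁ > q₂ be odd positive integers whose Jacobi symbols satisfy (2/q₁) = (2/q₂) = −1, and suppose (q₁² − q₂²)/4 = 2ʰ for some positive integer h. Then x ≠ q₁q₂ and z − x ≠ q₁q₂. -/
/-- The positive integers completing `15` to the legs of an integer right triangle. -/
theorem IsSq.eq_of_fifteen {y : ℤ} (hy : 0 < y) (h : IsSq (15 ^ 2 + y ^ 2)) :
    y = 8 ∨ y = 20 ∨ y = 36 ∨ y = 112 := by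
  obtain ⟨w, hw⟩ := h
  rw [← sq_abs w] at hw
  have hw0 := abs_nonneg w
  obtain ⟨d, hd⟩ : ∃ d, d = |w| - y := ⟨_, rfl⟩
  have hwd : |w| = y + d := by linarith
  rw [hwd] at hw
  have hprod : d * (d + 2 * y) = 225 := by linarith
  have hd0 : 0 < d := by nlinarith
  have hd15 : d < 15 := by nlinarith
  interval_cases d <;> omega

/-- Two right triangles with common leg `15`, placed along a side of a square, do not extend
to a point at integer distance from a third vertex. -/
theorem not_isSq_of_fifteen {y t : ℤ} (hy : 0 < y) (ht : 0 < t)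
    (h₁ : IsSq (15 ^ 2 + y ^ 2)) (h₂ : IsSq (15 ^ 2 + t ^ 2))
    (h₃ : IsSq ((y + t - 15) ^ 2 + y ^ 2)) : False := by
  replace h₃ := isSquare_iff_exists_sq _ |>.mpr h₃
  rcases h₁.eq_of_fifteen hy with rfl | rfl | rfl | rfl <;>
    rcases h₂.eq_of_fifteen ht with rfl | rfl | rfl | rfl <;>
    norm_num at h₃

theorem mod_eight_of_jacobiSym_two_eq_neg_one {q : ℕ} (hq : Odd q) (h : jacobiSym 2 q = -1) :
    q % 8 = 3 ∨ q % 8 = 5 := by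
  rw [jacobiSym.at_two hq, ZMod.χ₈_nat_eq_if_mod_eight] at h
  have := Nat.odd_iff.mp hq
  split_ifs at h
  omega

/-- Odd numbers whose squares differ by four times a power of two are consecutive odd numbers
around that power. -/
theorem eq_two_pow_add_one_of_sq_sub_sq {q₁ q₂ : ℕ} (h₁ : Odd q₁) (h₂ : Odd q₂) (hlt : q₂ < q₁)
    {h : ℕ} (heq : (q₁ ^ 2 - q₂ ^ 2) / 4 = 2 ^ h) : q₁ = 2 ^ h + 1 ∧ q₁ = q₂ + 2 := by
  obtain ⟨m, hm⟩ := h₁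
  obtain ⟨n, hn⟩ := h₂
  obtain ⟨a, rfl⟩ := Nat.exists_eq_add_of_lt (show n < m by omega)
  have hprod : (a + 1) * (2 * n + a + 2) = 2 ^ h := by
    rw [← heq, hm, hn, show (2 * (n + a + 1) + 1) ^ 2 - (2 * n + 1) ^ 2
      = 4 * ((a + 1) * (2 * n + a + 2)) from Nat.sub_eq_of_eq_add (by ring)]
    omega
  obtain ⟨i, -, hi⟩ := (Nat.dvd_prime_pow Nat.prime_two).mp (Dvd.intro _ hprod)
  obtain ⟨j, -, hj⟩ := (Nat.dvd_prime_pow Nat.prime_two).mp (Dvd.intro_left _ hprod)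
  rcases i with _ | i
  · obtain rfl : a = 0 := by simpa using hi
    omega
  · rcases j with _ | j
    · simp at hj
    · rw [pow_succ] at hi hj
      omega

theorem eq_five_three_of_jacobiSym {q₁ q₂ : ℕ} (ho₁ : Odd q₁) (ho₂ : Odd q₂) (hlt : q₂ < q₁)
    (hj₁ : jacobiSym 2 q₁ = -1) (hj₂ : jacobiSym 2 q₂ = -1)
    {h : ℕ} (heq : (q₁ ^ 2 - q₂ ^ 2) / 4 = 2 ^ h) : q₁ = 5 ∧ q₂ = 3 := by
  obtain ⟨e₁, e₂⟩ := eq_two_pow_add_one_of_sq_sub_sq ho₁ ho₂ hlt heq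
  have m₁ := mod_eight_of_jacobiSym_two_eq_neg_one ho₁ hj₁
  have m₂ := mod_eight_of_jacobiSym_two_eq_neg_one ho₂ hj₂
  rcases h with _ | _ | _ | h
  · omega
  · omega
  · omega
  · rw [pow_add] at e₁
    omega

/-- Corollary 5.3: neither `x` nor `z - x` can equal `q₁ * q₂` for odd positive
integers `q₁ > q₂` with Jacobi symbols `(2/q₁) = (2/q₂) = -1` and
`(q₁² - q₂²)/4 = 2 ^ h` for a positive integer `h`. -/
theorem x_not_q1q2_pow2 (x y z : ℤ) (hadm : Admissible x y z)
    (hx : Odd x) (hy : Even y)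
    (q₁ q₂ : ℕ) (hq₁odd : Odd q₁) (hq₂odd : Odd q₂)
    (hq₁pos : 0 < q₁) (hq₂pos : 0 < q₂) (hqlt : q₂ < q₁)
    (hj₁ : jacobiSym 2 q₁ = -1) (hj₂ : jacobiSym 2 q₂ = -1)
    (h : ℕ) (hh : 0 < h)
    (heq : (q₁ ^ 2 - q₂ ^ 2) / 4 = 2 ^ h) :
    x ≠ (q₁ : ℤ) * q₂ ∧ z - x ≠ (q₁ : ℤ) * q₂ := by
  obtain ⟨rfl, rfl⟩ := eq_five_three_of_jacobiSym hq₁odd hq₂odd hqlt hj₁ hj₂ heq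
  obtain ⟨-, -, hy0, hyz, -, s₁, s₂, s₃, s₄⟩ := hadm
  have ht : 0 < z - y := by linarith
  constructor
  · intro hx15
    obtain rfl : x = 15 := by simpa using hx15
    refine not_isSq_of_fifteen hy0 ht s₁ s₂ ?_
    rwa [add_sub_cancel]
  · intro hx15
    have hzx : z - x = 15 := by simpa using hx15
    rw [hzx] at s₃ s₄
    have hx' : y + (z - y) - 15 = x := by linarith
    refine not_isSq_of_fifteen hy0 ht s₃ s₄ ?_
    rwa [hx']
end

section
/- Let (x, y, z) be an admissible configuration with x odd and y even. Let p₁ ≠ p₂ and q₁ ≠ q₂ be odd primes such that 2 is a quadratic non-residue modulo each of p₁, p₂, q₁, q₂. Then it is not the case that x = p₁p₂ and z − x = q₁q₂. -/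
/-- The equation `u ^ 4 + 4 * c ^ 4 = w ^ 2` has no coprime integer solution with `u` odd and
`c` nonzero. -/
theorem pow_four_add_four_mul_pow_four_ne_sq_s14 (u c w : ℤ) (hu : Odd u) (hc : c ≠ 0)
    (huc : IsCoprime u c) : u ^ 4 + 4 * c ^ 4 ≠ w ^ 2 := by
  induction hk : c.natAbs using Nat.strong_induction_on generalizing u c w with
  | _ k ih =>
  subst hk
  intro h
  wlog hw : 0 ≤ w generalizing w
  · exact this (-w) (by rw [h]; ring) (by omega)
  have hu0 : u ≠ 0 := by rintro rfl; simp at hu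
  have hwpos : 0 < w := by
    refine lt_of_le_of_ne hw ?_
    rintro rfl
    have : 0 < u ^ 4 := by positivity
    have : 0 < c ^ 4 := by positivity
    linarith
  have hu2c : IsCoprime u (2 * c) :=
    IsCoprime.mul_right (by obtain ⟨k, rfl⟩ := hu; exact ⟨1, -k, by ring⟩) huc
  have hcop : Int.gcd (u ^ 2) (2 * c ^ 2) = 1 := by
    rw [← Int.isCoprime_iff_gcd_eq_one]
    exact (IsCoprime.mul_right hu2c.of_mul_right_left (huc.pow_right)).pow_left
  obtain ⟨m, n, hm, hn, hwmn, hmn, -, hm0⟩ :=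
    PythagoreanTriple.coprime_classification' (x := u ^ 2) (y := 2 * c ^ 2) (z := w)
      (by unfold PythagoreanTriple; linear_combination h) hcop
      (Int.odd_iff.mp hu.pow) hwpos
  have hmnc : m * n = c ^ 2 := by linarith
  have hc2 : 0 < c ^ 2 := by positivity
  have hmpos : 0 < m := lt_of_le_of_ne hm0 (by rintro rfl; simp at hmnc; omega)
  have hnpos : 0 < n := by
    rw [← hmnc] at hc2
    exact (mul_pos_iff_of_pos_left hmpos).mp hc2
  have hmn' : IsCoprime m n := Int.isCoprime_iff_gcd_eq_one.mpr hmn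
  obtain ⟨M, hM⟩ := Int.sq_of_isCoprime hmn' hmnc
  replace hM : m = M ^ 2 := by
    rcases hM with hM | hM
    · exact hM
    · nlinarith [sq_nonneg M]
  obtain ⟨N, hN⟩ := Int.sq_of_isCoprime hmn'.symm ((mul_comm n m).trans hmnc)
  replace hN : n = N ^ 2 := by
    rcases hN with hN | hN
    · exact hN
    · nlinarith [sq_nonneg N]
  have hun : Int.gcd u n = 1 := by
    rw [← Int.isCoprime_iff_gcd_eq_one]
    exact huc.pow_right.of_isCoprime_of_dvd_right ⟨m, by rw [← hmnc]; ring⟩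
  obtain ⟨r, s, hr, hs, hmrs, hrs, hpar, -⟩ :=
    PythagoreanTriple.coprime_classification' (x := u) (y := n) (z := m)
      (by unfold PythagoreanTriple; linear_combination hm) hun (Int.odd_iff.mp hu) hmpos
  -- the even one of `r` and `s` gives the smaller solution
  have descend : ∀ r s : ℤ, r % 2 = 0 → s % 2 = 1 → IsCoprime r s → n = 2 * r * s →
      m = r ^ 2 + s ^ 2 → False := by
    intro r s hr2 hs2 hrs hn' hm'
    obtain ⟨t, rfl⟩ : (2 : ℤ) ∣ r := Int.dvd_of_emod_eq_zero hr2
    have hNe : Even N := by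
      have : Even (N ^ 2) := ⟨2 * t * s, by rw [← hN, hn']; ring⟩
      exact (Int.even_pow.mp this).1
    obtain ⟨e, rfl⟩ := hNe
    have hts : t * s = e ^ 2 := by linarith [hn'.symm.trans hN, (by ring : (e + e) ^ 2 = 4 * e ^ 2), (by ring : 2 * (2 * t) * s = 4 * (t * s))]
    have htcop : IsCoprime t s := hrs.of_mul_left_right
    obtain ⟨R, hR⟩ := Int.sq_of_isCoprime htcop hts
    obtain ⟨S, hS⟩ := Int.sq_of_isCoprime htcop.symm ((mul_comm s t).trans hts)
    have ht2 : t ^ 2 = R ^ 4 := by rcases hR with h | h <;> rw [h] <;> ring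
    have hs2' : s ^ 2 = S ^ 4 := by rcases hS with h | h <;> rw [h] <;> ring
    have he : e ≠ 0 := by rintro rfl; simp at hN; omega
    have ht0 : t ≠ 0 := by rintro rfl; simp at hts; exact he (pow_eq_zero_iff two_ne_zero |>.mp hts.symm)
    have hs0 : s ≠ 0 := by rintro rfl; simp at hts; exact he (pow_eq_zero_iff two_ne_zero |>.mp hts.symm)
    have hR0 : R ≠ 0 := by rintro rfl; simp at hR; exact ht0 hR
    have hSodd : Odd S := by
      have : Odd (S ^ 4) := by rw [← hs2']; exact (Int.odd_iff.mpr hs2).pow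
      exact (Int.odd_pow.mp this).resolve_right (by norm_num)
    have hSR : IsCoprime S R := by
      have : IsCoprime (S ^ 4) (R ^ 4) := by
        rw [← ht2, ← hs2']; exact htcop.symm.pow
      exact (IsCoprime.pow_iff (by norm_num) (by norm_num)).mp this
    refine ih R.natAbs ?_ S R M hSodd hR0 hSR rfl ?_
    · rw [Int.natAbs_lt_iff_sq_lt]
      have h1 : R ^ 2 ≤ e ^ 2 := by
        have : (R ^ 2) ^ 2 ≤ (e ^ 2) ^ 2 := by
          have hs1 : 1 ≤ s ^ 2 := Int.add_one_le_iff.mpr (sq_pos_of_ne_zero hs0)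
          calc (R ^ 2) ^ 2 = t ^ 2 * 1 := by rw [ht2]; ring
            _ ≤ t ^ 2 * s ^ 2 := mul_le_mul_of_nonneg_left hs1 (sq_nonneg t)
            _ = (e ^ 2) ^ 2 := by rw [← hts]; ring
        exact (sq_le_sq₀ (by positivity) (by positivity)).mp this
      have : 0 < e ^ 2 := by positivity
      have hce : c ^ 2 = m * (4 * e ^ 2) := by rw [← hmnc, hN]; ring
      nlinarith [mul_le_mul_of_nonneg_right (Int.add_one_le_iff.mpr hmpos) this.le]
    · rw [← hM, hm', ← hs2', ← mul_one (4 : ℤ), mul_assoc, one_mul, ← ht2]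
      ring
  have hrs' : IsCoprime r s := Int.isCoprime_iff_gcd_eq_one.mpr hrs
  rcases hpar with ⟨h1, h2⟩ | ⟨h1, h2⟩
  · exact descend r s h1 h2 hrs' hs hmrs
  · exact descend s r h2 h1 hrs'.symm (by rw [hs]; ring) (by rw [hmrs]; ring)

/-- No admissible configuration with `x` odd and `y` even has `P` on the horizontal midline. -/
theorem Admissible.two_mul_ne {x y z : ℤ} (h : Admissible x y z) (hx : Odd x) (hy : Even y) :
    y ≠ z - y := by
  intro hyz
  obtain ⟨-, -, hy0, -, hgcd, ⟨v, hv⟩, -, ⟨w, hw⟩, -⟩ := h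
  obtain rfl : z = 2 * y := by linarith
  refine pow_four_add_four_mul_pow_four_ne_sq_s14 (x - y) y (v * w) (hx.sub_even hy) hy0.ne' ?_
    (by rw [mul_pow, ← hv, ← hw]; ring)
  have : IsCoprime x y := by
    rw [Int.isCoprime_iff_gcd_eq_one]
    simpa [← Int.gcd_assoc, hy0.le, abs_of_pos hy0] using hgcd
  simpa [sub_eq_add_neg] using this.add_mul_right_left (-1)

/-- The second leg of a Pythagorean triangle whose first leg is a product of two distinct odd
primes. -/
theorem two_mul_leg_of_isSq {q r : ℕ} (hq : q.Prime) (hr : r.Prime) (hqr : q < r) {c : ℤ}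
    (hc : 0 < c) (h : IsSq (((q : ℤ) * r) ^ 2 + c ^ 2)) :
    2 * c = (q * r) ^ 2 - 1 ∨ 2 * c = q * (r ^ 2 - 1) ∨ 2 * c = r * (q ^ 2 - 1) ∨
      2 * c = r ^ 2 - q ^ 2 := by
  obtain ⟨w, hw⟩ := h
  wlog hw0 : 0 ≤ w generalizing w
  · exact this (-w) (by rw [hw]; ring) (by omega)
  have hq0 : (0 : ℤ) < q := by exact_mod_cast hq.pos
  have hr0 : (0 : ℤ) < r := by exact_mod_cast hr.pos
  have hqr' : (q : ℤ) < r := by exact_mod_cast hqr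
  have hcw : c < w := by
    have : 0 < ((q : ℤ) * r) ^ 2 := by positivity
    nlinarith
  obtain ⟨d, hd⟩ := Int.eq_ofNat_of_zero_le (sub_nonneg.mpr hcw.le)
  have hprod : (d : ℤ) * (d + 2 * c) = (q * r) ^ 2 := by
    rw [← hd]; linear_combination -hw
  have hdvd : d ∣ q ^ 2 * r ^ 2 := by
    rw [← Int.natCast_dvd_natCast]
    exact ⟨d + 2 * c, by push_cast; rw [hprod]; ring⟩
  have hdpos : (0 : ℤ) < d := by omega
  obtain ⟨s, t, hs, ht, rfl⟩ := (Nat.dvd_mul).mp hdvd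
  obtain ⟨i, hi, rfl⟩ := (Nat.dvd_prime_pow hq).mp hs
  obtain ⟨j, hj, rfl⟩ := (Nat.dvd_prime_pow hr).mp ht
  have hlt : (((q ^ i * r ^ j : ℕ) : ℤ)) ^ 2 < (q * r) ^ 2 := by
    rw [← hprod]; nlinarith
  have hlt' : q ^ i * r ^ j < q * r := by
    have := lt_of_pow_lt_pow_left₀ 2 (by positivity) hlt
    exact_mod_cast this
  have hne {k : ℤ} (hk : 0 < k) {f : ℤ} (hf : k * (k + 2 * c) = k * (k + f)) : 2 * c = f := by
    have := mul_left_cancel₀ hk.ne' hf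
    linarith
  interval_cases i <;> interval_cases j
  · left; apply hne hdpos; rw [hprod]; push_cast; ring
  · right; right; left; apply hne hdpos; rw [hprod]; push_cast; ring
  · nlinarith
  · right; left; apply hne hdpos; rw [hprod]; push_cast; ring
  · simp at hlt'
  · nlinarith [Nat.mul_pos hq.pos hr.pos, hr.two_le]
  · right; right; right; apply hne hdpos; rw [hprod]; push_cast; ring
  · nlinarith [Nat.mul_pos hq.pos hr.pos, hq.two_le]
  · nlinarith [Nat.mul_pos hq.pos hr.pos, Nat.mul_pos hq.pos hq.pos]

theorem leg_of_isSq_of_lt {q r : ℕ} (hq : q.Prime) (hr : r.Prime) (hqodd : Odd q)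
    (hrodd : Odd r) (hqr : q < r) {c : ℤ} (hc : 0 < c) (hlt : c < 2 * (q * r))
    (h : IsSq (((q : ℤ) * r) ^ 2 + c ^ 2)) :
    (q = 3 ∧ c = 4 * r) ∨ 2 * c = r ^ 2 - q ^ 2 := by
  have hq3 : 3 ≤ q := by
    have := hq.two_le
    obtain ⟨k, rfl⟩ := hqodd
    omega
  have hr5 : 5 ≤ r := by
    obtain ⟨k, rfl⟩ := hqodd
    obtain ⟨l, rfl⟩ := hrodd
    omega
  have hq3' : (3 : ℤ) ≤ q := by exact_mod_cast hq3
  have hr5' : (5 : ℤ) ≤ r := by exact_mod_cast hr5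
  rcases two_mul_leg_of_isSq hq hr hqr hc h with h | h | h | h
  · nlinarith [mul_le_mul hq3' hr5' (by norm_num) (by linarith)]
  · have : (r : ℤ) ^ 2 - 1 < 4 * r := by
      refine lt_of_mul_lt_mul_left (a := (q : ℤ)) ?_ (by linarith)
      linarith
    nlinarith
  · have h4 : (q : ℤ) ^ 2 - 1 < 4 * q := by
      refine lt_of_mul_lt_mul_left (a := (r : ℤ)) ?_ (by linarith)
      linarith
    have : (q : ℤ) < 5 := by nlinarith
    obtain rfl : q = 3 := by
      obtain ⟨k, rfl⟩ := hqodd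
      omega
    left
    push_cast at h
    exact ⟨rfl, by linarith⟩
  · exact Or.inr h

theorem legs_eq_of_isSq {q r : ℕ} (hq : q.Prime) (hr : r.Prime) (hqodd : Odd q) (hrodd : Odd r)
    (hqr : q ≠ r) {a c d : ℤ} (ha : a ≤ q * r) (hc : 0 < c) (hd : 0 < d)
    (hsum : a + q * r = c + d) (hac : IsSq (a ^ 2 + c ^ 2)) (had : IsSq (a ^ 2 + d ^ 2))
    (hbc : IsSq (((q : ℤ) * r) ^ 2 + c ^ 2)) (hbd : IsSq (((q : ℤ) * r) ^ 2 + d ^ 2)) :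
    c = d := by
  wlog hlt : q < r generalizing q r
  · rw [mul_comm] at ha hsum hbc hbd
    exact this hr hq hrodd hqodd hqr.symm ha hsum hbc hbd (by omega)
  have mixed : ∀ c d : ℤ, q = 3 → a + q * r = c + d → IsSq (a ^ 2 + c ^ 2) → c = 4 * r →
      2 * d = r ^ 2 - q ^ 2 → False := by
    rintro c d rfl hsum ⟨w, hw⟩ rfl hd
    push_cast at *
    have hr5 : r = 5 := by
      have : (r : ℤ) < 6 := by nlinarith
      obtain ⟨k, rfl⟩ := hrodd
      omega
    subst hr5
    obtain rfl : a = 13 := by push_cast at *; linarith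
    have h1 : 23 < |w| := lt_of_pow_lt_pow_left₀ 2 (abs_nonneg w) (by rw [sq_abs, ← hw]; norm_num)
    have h2 : |w| < 24 := lt_of_pow_lt_pow_left₀ 2 (by norm_num) (by rw [sq_abs, ← hw]; norm_num)
    omega
  rcases leg_of_isSq_of_lt hq hr hqodd hrodd hlt hc (by linarith) hbc with ⟨h3, h⟩ | h <;>
    rcases leg_of_isSq_of_lt hq hr hqodd hrodd hlt hd (by linarith) hbd with ⟨h3', h'⟩ | h'
  · rw [h, h']
  · exact (mixed c d h3 hsum hac h h').elim
  · exact (mixed d c h3' (by linarith) had h' h).elim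
  · linarith

/-- Theorem 6: `x` and `z - x` cannot be `p₁ p₂` and `q₁ q₂` for odd primes
`p₁ ≠ p₂`, `q₁ ≠ q₂` modulo each of which `2` is a quadratic non-residue. -/
theorem x_zx_not_products (x y z : ℤ) (hadm : Admissible x y z)
    (hx : Odd x) (hy : Even y)
    (p₁ p₂ q₁ q₂ : ℕ)
    (hp₁ : p₁.Prime) (hp₂ : p₂.Prime) (hq₁ : q₁.Prime) (hq₂ : q₂.Prime)
    (hp₁odd : Odd p₁) (hp₂odd : Odd p₂) (hq₁odd : Odd q₁) (hq₂odd : Odd q₂)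
    (hpne : p₁ ≠ p₂) (hqne : q₁ ≠ q₂)
    (hnr₁ : ¬ ∃ w : ℤ, w ^ 2 ≡ 2 [ZMOD (p₁ : ℤ)])
    (hnr₂ : ¬ ∃ w : ℤ, w ^ 2 ≡ 2 [ZMOD (p₂ : ℤ)])
    (hnr₃ : ¬ ∃ w : ℤ, w ^ 2 ≡ 2 [ZMOD (q₁ : ℤ)])
    (hnr₄ : ¬ ∃ w : ℤ, w ^ 2 ≡ 2 [ZMOD (q₂ : ℤ)]) :
    ¬ (x = (p₁ : ℤ) * p₂ ∧ z - x = (q₁ : ℤ) * q₂) := by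
  rintro ⟨hxp, hzq⟩
  refine hadm.two_mul_ne hx hy ?_
  obtain ⟨-, -, hy0, hyz, -, h₁, h₂, h₃, h₄⟩ := hadm
  have hd : 0 < z - y := by linarith
  rcases le_total x (z - x) with hle | hle
  · rw [hzq] at hle h₃ h₄
    exact legs_eq_of_isSq hq₁ hq₂ hq₁odd hq₂odd hqne hle hy0 hd (by linarith) h₁ h₂ h₃ h₄
  · have hsum : z - x + (p₁ : ℤ) * p₂ = y + (z - y) := by rw [← hxp]; ring
    rw [hxp] at h₁ h₂
    exact legs_eq_of_isSq hp₁ hp₂ hp₁odd hp₂odd hpne (hxp ▸ hle) hy0 hd hsum h₃ h₄ h₁ h₂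
end
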